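/- arXiv:math/0610547 — 3 statements merged into one kernel-verified Lean document; each statement's English description precedes it below -/
import Mathlib

section
/- If X is an asymptotically transitive Banach space, then the function η̌(y) = inf_{ε>0} sup{‖I − f⊗y‖ : f ∈ (1+ε)B_{X*}, f(y) = 1} is constant on the unit sphere of X. -/
/-- `η̌(y) = inf_{ε>0} sup{‖I − f⊗y‖ : ‖f‖ ≤ 1+ε, f(y) = 1}`. -/
noncomputable def etaCheck {X : Type*} [NormedAddCommGroup X] [NormedSpace ℝ X] (y : X) : ℝ :=
  ⨅ ε : Set.Ioi (0 : ℝ), sSup {r : ℝ | ∃ f : X →L[ℝ] ℝ, ‖f‖ ≤ 1 + (ε : ℝ) ∧ f y = 1 ∧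
    ‖ContinuousLinearMap.id ℝ X - f.smulRight y‖ = r}

/-- The set of norms of the projections `I − f⊗y` with `‖f‖ ≤ 1+ε` and `f(y) = 1`. -/
def projNorms {X : Type*} [NormedAddCommGroup X] [NormedSpace ℝ X] (y : X) (ε : ℝ) : Set ℝ :=
  {r : ℝ | ∃ f : X →L[ℝ] ℝ, ‖f‖ ≤ 1 + ε ∧ f y = 1 ∧
    ‖ContinuousLinearMap.id ℝ X - f.smulRight y‖ = r}

section

variable {X : Type*} [NormedAddCommGroup X] [NormedSpace ℝ X]

lemma projNorms_nonneg (y : X) (ε : ℝ) : ∀ r ∈ projNorms y ε, 0 ≤ r := by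
  rintro r ⟨f, -, -, rfl⟩
  exact norm_nonneg _

lemma projNorms_bddAbove (y : X) (ε : ℝ) : BddAbove (projNorms y ε) := by
  refine ⟨‖ContinuousLinearMap.id ℝ X‖ + (1 + ε) * ‖y‖, ?_⟩
  rintro r ⟨f, hf, -, rfl⟩
  refine (norm_sub_le _ _).trans ?_
  rw [ContinuousLinearMap.norm_smulRight_apply]
  gcongr

/-- Conjugating by an automorphism that maps `y` to `x` compares the two suprema. -/
lemma sSup_projNorms_le {x y : X} {ε δ : ℝ} (hδ : 0 < δ) (hδε : (1 + δ) ^ 2 ≤ 1 + ε)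
    (T : X ≃L[ℝ] X) (hT : T y = x) (h1 : ‖(T : X →L[ℝ] X)‖ ≤ 1 + δ)
    (h2 : ‖(T.symm : X →L[ℝ] X)‖ ≤ 1 + δ) :
    sSup (projNorms x δ) ≤ (1 + δ) ^ 2 * sSup (projNorms y ε) := by
  have h0 : 0 ≤ sSup (projNorms y ε) := Real.sSup_nonneg (projNorms_nonneg y ε)
  refine Real.sSup_le ?_ (by positivity)
  rintro r ⟨f, hf, hfx, rfl⟩
  set g : X →L[ℝ] ℝ := f.comp (T : X →L[ℝ] X) with hg
  have hgn : ‖g‖ ≤ 1 + ε := by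
    calc ‖g‖ ≤ ‖f‖ * ‖(T : X →L[ℝ] X)‖ := f.opNorm_comp_le _
      _ ≤ (1 + δ) * (1 + δ) := by gcongr
      _ ≤ 1 + ε := by linarith [sq (1 + δ)]
  have hmem : ‖ContinuousLinearMap.id ℝ X - g.smulRight y‖ ≤ sSup (projNorms y ε) :=
    le_csSup (projNorms_bddAbove y ε) ⟨g, hgn, by simp [hg, hT, hfx], rfl⟩
  have hconj : ContinuousLinearMap.id ℝ X - f.smulRight x =
      (T : X →L[ℝ] X).comp
        ((ContinuousLinearMap.id ℝ X - g.smulRight y).comp (T.symm : X →L[ℝ] X)) := by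
    ext z
    simp [hg, hT]
  calc ‖ContinuousLinearMap.id ℝ X - f.smulRight x‖
      ≤ ‖(T : X →L[ℝ] X)‖ *
          (‖ContinuousLinearMap.id ℝ X - g.smulRight y‖ * ‖(T.symm : X →L[ℝ] X)‖) := by
        rw [hconj]
        refine (ContinuousLinearMap.opNorm_comp_le _ _).trans ?_
        gcongr
        exact ContinuousLinearMap.opNorm_comp_le _ _
    _ ≤ (1 + δ) * (sSup (projNorms y ε) * (1 + δ)) := by gcongr
    _ = (1 + δ) ^ 2 * sSup (projNorms y ε) := by ring

lemma etaCheck_le_sSup (x : X) {δ : ℝ} (hδ : 0 < δ) : etaCheck x ≤ sSup (projNorms x δ) := by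
  have hb : BddBelow (Set.range fun ε : Set.Ioi (0 : ℝ) => sSup (projNorms x ε)) := by
    refine ⟨0, ?_⟩
    rintro r ⟨ε, rfl⟩
    exact Real.sSup_nonneg (projNorms_nonneg x ε)
  exact ciInf_le hb ⟨δ, hδ⟩

open Filter Topology in
lemma etaCheck_le_of_almost_isometries {x y : X}
    (h : ∀ ε > 0, ∃ T : X ≃L[ℝ] X,
      T y = x ∧ ‖(T : X →L[ℝ] X)‖ ≤ 1 + ε ∧ ‖(T.symm : X →L[ℝ] X)‖ ≤ 1 + ε) :
    etaCheck x ≤ etaCheck y := by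
  have : Nonempty (Set.Ioi (0 : ℝ)) := ⟨⟨1, Set.mem_Ioi.2 one_pos⟩⟩
  refine le_ciInf fun ⟨ε, hε⟩ => ?_
  change etaCheck x ≤ sSup (projNorms y ε)
  replace hε : 0 < ε := hε
  have hsq : Tendsto (fun δ : ℝ => (1 + δ) ^ 2) (𝓝[>] 0) (𝓝 1) := by
    have hc : Continuous fun δ : ℝ => (1 + δ) ^ 2 := by fun_prop
    simpa using (hc.tendsto 0).mono_left nhdsWithin_le_nhds
  have hlim := hsq.mul_const (sSup (projNorms y ε))
  rw [one_mul] at hlim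
  refine ge_of_tendsto hlim ?_
  filter_upwards [self_mem_nhdsWithin, hsq.eventually_le_const (by linarith : 1 < 1 + ε)]
    with δ hδ hδε
  obtain ⟨T, hT, h1, h2⟩ := h δ hδ
  exact (etaCheck_le_sSup x hδ).trans (sSup_projNorms_le hδ hδε T hT h1 h2)

end

theorem stmt_8 {X : Type*} [NormedAddCommGroup X] [NormedSpace ℝ X] [CompleteSpace X]
    (hAT : ∀ x y : X, ‖x‖ = 1 → ‖y‖ = 1 → ∀ ε > 0, ∃ T : X ≃L[ℝ] X,
      T x = y ∧ ‖(T : X →L[ℝ] X)‖ ≤ 1 + ε ∧ ‖(T.symm : X →L[ℝ] X)‖ ≤ 1 + ε) :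
    ∀ x y : X, ‖x‖ = 1 → ‖y‖ = 1 → etaCheck x = etaCheck y := by
  intro x y hx hy
  exact le_antisymm (etaCheck_le_of_almost_isometries (hAT y x hy hx))
    (etaCheck_le_of_almost_isometries (hAT x y hx hy))
end

section
/- Let X be an asymptotically transitive Banach space of dimension at least 3 such that for every ε > 0 there exists a 1-codimensional subspace Z_ε ⊂ X and a linear projection P_ε : X → Z_ε with ‖P_ε‖ ≤ 1 + ε. Then X is isometrically isomorphic to a Hilbert space. -/
section Helpers

open Filter Topology Set

theorem tendsto_prod_one_add_of_logSubgradient {G s : ℝ → ℝ} {K : ℝ}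
    (hG : ∀ t ∈ Icc (0 : ℝ) 1, 0 < G t) (hs : ∀ t ∈ Icc (0 : ℝ) 1, |s t| ≤ K)
    (h : ∀ t ∈ Icc (0 : ℝ) 1, ∀ u ∈ Icc (0 : ℝ) 1, G t * (1 + s t * (u - t)) ≤ G u) :
    Tendsto (fun n : ℕ => ∏ i ∈ Finset.range n, (1 + s (i / n) / n)) atTop
      (𝓝 (G 1 / G 0)) := by
  have h0 : (0 : ℝ) ∈ Icc (0 : ℝ) 1 := by simp
  have h1 : (1 : ℝ) ∈ Icc (0 : ℝ) 1 := by simp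
  have hK : 0 ≤ K := (abs_nonneg _).trans (hs 0 h0)
  have hinv : Tendsto (fun n : ℕ => K / (n : ℝ)) atTop (𝓝 0) :=
    tendsto_const_div_atTop_nhds_zero_nat K
  have hinv2 : Tendsto (fun n : ℕ => K ^ 2 / (n : ℝ)) atTop (𝓝 0) :=
    tendsto_const_div_atTop_nhds_zero_nat _
  have hlow : Tendsto (fun n : ℕ => (1 - K ^ 2 / (n : ℝ)) * (1 - K / n) / (1 + K / n) *
      (G 1 / G 0)) atTop (𝓝 (G 1 / G 0)) := by
    have := (((hinv2.const_sub 1).mul (hinv.const_sub 1)).div (hinv.const_add 1)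
      (by norm_num)).mul_const (G 1 / G 0)
    simpa using this
  have hev : ∀ᶠ n : ℕ in atTop, 0 < (n : ℝ) ∧ K / n < 1 ∧ K ^ 2 / n < 1 := by
    filter_upwards [eventually_gt_atTop 0, hinv.eventually (gt_mem_nhds one_pos),
      hinv2.eventually (gt_mem_nhds one_pos)] with n hn h2 h3
    exact ⟨by exact_mod_cast hn, h2, h3⟩
  have hmem : ∀ n m : ℕ, 0 < (n : ℝ) → m ≤ n → (m / n : ℝ) ∈ Icc (0 : ℝ) 1 := by
    intro n m hn hm
    refine ⟨by positivity, (div_le_one hn).2 (by exact_mod_cast hm)⟩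
  have hsn : ∀ n m : ℕ, 0 < (n : ℝ) → m ≤ n → |s (m / n) / n| ≤ K / n := by
    intro n m hn hm
    rw [abs_div, abs_of_pos hn]
    exact div_le_div_of_nonneg_right (hs _ (hmem n m hn hm)) hn.le
  refine tendsto_of_tendsto_of_tendsto_of_le_of_le' hlow tendsto_const_nhds ?_ ?_
  · filter_upwards [hev] with n ⟨hn, hKn, hK2n⟩
    have key : ∀ m : ℕ, m ≤ n → (1 - (K / n) ^ 2) ^ m * (1 - K / n) * G (m / n) ≤
        (∏ i ∈ Finset.range m, (1 + s (i / n) / n)) * (1 + s (m / n) / n) * G 0 := by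
      intro m
      induction m with
      | zero =>
        intro _
        have := abs_le.1 (hsn n 0 hn (Nat.zero_le _))
        have hG0 := hG 0 h0
        simp only [pow_zero, one_mul, Finset.range_zero, Finset.prod_empty, Nat.cast_zero,
          zero_div] at this ⊢
        gcongr
        linarith
      | succ m ih =>
        intro hm
        have ih := ih (by omega)
        rw [Finset.prod_range_succ]
        have hb := abs_le.1 (hsn n (m + 1) hn hm)
        have hstep := h _ (hmem n (m + 1) hn hm) _ (hmem n m hn (by omega))
        have hdiff : (m / n : ℝ) - ((m + 1 : ℕ) / n : ℝ) = - (1 / n) := by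
          push_cast; field_simp; ring
        rw [hdiff] at hstep
        set σ := s ((m + 1 : ℕ) / n) / n with hσ
        have hσ' : s ((m + 1 : ℕ) / n) * -(1 / (n : ℝ)) = - σ := by rw [hσ]; ring
        rw [hσ'] at hstep
        have hGp := hG _ (hmem n (m + 1) hn hm)
        have hKn0 : 0 ≤ K / n := by positivity
        have hq : 0 ≤ (1 - (K / n) ^ 2) := by nlinarith
        have hsq : σ ^ 2 ≤ (K / n) ^ 2 := sq_le_sq' hb.1 hb.2
        calc (1 - (K / n) ^ 2) ^ (m + 1) * (1 - K / n) * G ((m + 1 : ℕ) / n)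
            = (1 - (K / n) ^ 2) ^ m * (1 - K / n) * (G ((m + 1 : ℕ) / n) * (1 - (K / n) ^ 2)) := by
              ring
          _ ≤ (1 - (K / n) ^ 2) ^ m * (1 - K / n) *
                (G ((m + 1 : ℕ) / n) * (1 + -σ) * (1 + σ)) := by
              apply mul_le_mul_of_nonneg_left _ (mul_nonneg (pow_nonneg hq _) (by linarith))
              nlinarith
          _ ≤ (1 - (K / n) ^ 2) ^ m * (1 - K / n) * (G (m / n) * (1 + σ)) := by
              apply mul_le_mul_of_nonneg_left _ (mul_nonneg (pow_nonneg hq _) (by linarith))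
              exact mul_le_mul_of_nonneg_right hstep (by linarith)
          _ = ((1 - (K / n) ^ 2) ^ m * (1 - K / n) * G (m / n)) * (1 + σ) := by ring
          _ ≤ _ := mul_le_mul_of_nonneg_right ih (by linarith)
          _ = _ := by ring
    have hfin := key n le_rfl
    rw [div_self hn.ne'] at hfin
    have hb := abs_le.1 (hsn n n hn le_rfl)
    rw [div_self hn.ne'] at hb
    have hKn0 : 0 ≤ K / n := by positivity
    have hber : 1 - K ^ 2 / n ≤ (1 - (K / n) ^ 2) ^ n := by
      have := one_add_mul_le_pow (a := -(K / n) ^ 2) (by nlinarith) n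
      calc 1 - K ^ 2 / n = 1 + n * -(K / n) ^ 2 := by field_simp; ring
        _ ≤ _ := this
        _ = _ := by ring
    have hprod : 0 ≤ ∏ i ∈ Finset.range n, (1 + s (i / n) / n) := by
      refine Finset.prod_nonneg fun i hi => ?_
      have := abs_le.1 (hsn n i hn (Finset.mem_range.1 hi).le)
      linarith
    have hG0 := hG 0 h0
    have hG1 := hG 1 h1
    rw [div_mul_div_comm, div_le_iff₀ (by positivity)]
    calc (1 - K ^ 2 / n) * (1 - K / n) * G 1 ≤ (1 - (K / n) ^ 2) ^ n * (1 - K / n) * G 1 := by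
          gcongr
      _ ≤ _ := hfin
      _ ≤ (∏ i ∈ Finset.range n, (1 + s (i / n) / n)) * (1 + K / n) * G 0 := by
          gcongr
          exact le_of_abs_le (hs 1 h1)
      _ = _ := by ring
  · filter_upwards [hev] with n ⟨hn, hKn, hK2n⟩
    have key : ∀ m : ℕ, m ≤ n →
        (∏ i ∈ Finset.range m, (1 + s (i / n) / n)) * G 0 ≤ G (m / n) := by
      intro m
      induction m with
      | zero => simp
      | succ m ih =>
        intro hm
        have hb := abs_le.1 (hsn n m hn (by omega))
        have hstep := h _ (hmem n m hn (by omega)) _ (hmem n (m + 1) hn hm)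
        have hdiff : ((m + 1 : ℕ) / n : ℝ) - (m / n : ℝ) = 1 / n := by
          push_cast; field_simp; ring
        rw [hdiff, mul_one_div] at hstep
        rw [Finset.prod_range_succ, mul_right_comm]
        exact (mul_le_mul_of_nonneg_right (ih (by omega)) (by linarith)).trans hstep
    have := key n le_rfl
    rw [div_self hn.ne'] at this
    rwa [le_div_iff₀ (hG 0 h0)]

theorem mul_div_mem_of_logSubgradient {G s : ℝ → ℝ} {K : ℝ}
    (hG : ∀ t ∈ Icc (0 : ℝ) 1, 0 < G t) (hs : ∀ t ∈ Icc (0 : ℝ) 1, |s t| ≤ K)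
    (h : ∀ t ∈ Icc (0 : ℝ) 1, ∀ u ∈ Icc (0 : ℝ) 1, G t * (1 + s t * (u - t)) ≤ G u)
    {S : ℝ → Set ℝ} (hS : IsClosed (S 1))
    (hstep : ∀ t ∈ Icc (0 : ℝ) 1, ∀ u ∈ Icc (0 : ℝ) 1, ∀ α ∈ S t,
      α * (1 + s t * (u - t)) ∈ S u)
    {α : ℝ} (hα : α ∈ S 0) : α * (G 1 / G 0) ∈ S 1 := by
  refine hS.mem_of_tendsto ((tendsto_prod_one_add_of_logSubgradient hG hs h).const_mul α) ?_
  filter_upwards [eventually_gt_atTop 0] with n hn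
  have hn : 0 < (n : ℝ) := by exact_mod_cast hn
  have hmem : ∀ m : ℕ, m ≤ n → (m / n : ℝ) ∈ Icc (0 : ℝ) 1 := fun m hm =>
    ⟨by positivity, (div_le_one hn).2 (by exact_mod_cast hm)⟩
  have key : ∀ m : ℕ, m ≤ n →
      α * ∏ i ∈ Finset.range m, (1 + s (i / n) / n) ∈ S (m / n) := by
    intro m
    induction m with
    | zero => simpa using hα
    | succ m ih =>
      intro hm
      have := hstep _ (hmem m (by omega)) _ (hmem (m + 1) hm) _ (ih (by omega))
      have hdiff : ((m + 1 : ℕ) / n : ℝ) - (m / n : ℝ) = 1 / n := by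
        push_cast; field_simp; ring
      rw [hdiff, mul_one_div] at this
      rwa [Finset.prod_range_succ, ← mul_assoc]
  have := key n le_rfl
  rwa [div_self hn.ne'] at this

/-- `x - f x • e` is a contractive projection along `e`. -/
def ContractsAlong {E : Type*} [NormedAddCommGroup E] [NormedSpace ℝ E]
    (e : E) (f : E →L[ℝ] ℝ) : Prop :=
  f e = 1 ∧ ∀ x, ‖x - f x • e‖ ≤ ‖x‖

section Normed

variable {E : Type*} [NormedAddCommGroup E] [NormedSpace ℝ E]

theorem ContractsAlong.neg {e : E} {f : E →L[ℝ] ℝ} (h : ContractsAlong e f) :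
    ContractsAlong (-e) (-f) := by
  refine ⟨by simp [h.1], fun x => ?_⟩
  simpa using h.2 x

theorem ContractsAlong.ne_zero {e : E} {f : E →L[ℝ] ℝ} (h : ContractsAlong e f) : e ≠ 0 := by
  rintro rfl
  simpa using h.1

theorem ContractsAlong.abs_mul_norm_le {e : E} {f : E →L[ℝ] ℝ} (h : ContractsAlong e f) (x : E) :
    |f x| * ‖e‖ ≤ 2 * ‖x‖ := by
  have h1 := h.2 x
  have h2 := norm_sub_le x (x - f x • e)
  rw [sub_sub_cancel, norm_smul, Real.norm_eq_abs] at h2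
  linarith

theorem ContractsAlong.norm_le_norm_add_smul {e : E} {f : E →L[ℝ] ℝ} (h : ContractsAlong e f)
    {x : E} (hx : f x = 0) (t : ℝ) : ‖x‖ ≤ ‖x + t • e‖ := by
  have := h.2 (x + t • e)
  simpa [hx, h.1] using this

theorem exists_contractsAlong_path {a b : E} (Q : (E →L[ℝ] ℝ) → Prop)
    (hab : ∀ s t : ℝ, s • a + t • b = 0 → s = 0 ∧ t = 0)
    (hex : ∀ t : ℝ, ∃ f, ContractsAlong (a + t • b) f ∧ Q f)
    {f₀ f₁ : E →L[ℝ] ℝ} (h₀ : ContractsAlong a f₀) (h₁ : ContractsAlong (a + b) f₁)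
    (hQ₀ : Q f₀) (hQ₁ : Q f₁) :
    ∃ (f : ℝ → E →L[ℝ] ℝ) (K : ℝ), f 0 = f₀ ∧ f 1 = f₁ ∧
      (∀ t, ContractsAlong (a + t • b) (f t) ∧ Q (f t)) ∧
      (∀ t ∈ Icc (0 : ℝ) 1, |f t b| ≤ K) ∧
      (∀ t, b - f t b • (a + t • b) ≠ 0) ∧
      ∀ t u, (b - f t b • (a + t • b)) - f u (b - f t b • (a + t • b)) • (a + u • b) =
        (1 + f t b * (u - t)) • (b - f u b • (a + u • b)) := by
  have : ∀ t : ℝ, ∃ f, (ContractsAlong (a + t • b) f ∧ Q f) ∧ (t = 0 → f = f₀) ∧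
      (t = 1 → f = f₁) := by
    intro t
    by_cases ht0 : t = 0
    · subst ht0
      exact ⟨f₀, ⟨by simpa using h₀, hQ₀⟩, by simp⟩
    by_cases ht1 : t = 1
    · subst ht1
      exact ⟨f₁, ⟨by simpa using h₁, hQ₁⟩, by simp⟩
    obtain ⟨f, hf⟩ := hex t
    exact ⟨f, hf, by simp [ht0], by simp [ht1]⟩
  choose f hf hf0 hf1 using this
  have hcont : ContinuousOn (fun t : ℝ => ‖a + t • b‖) (Icc 0 1) := by fun_prop
  obtain ⟨τ, hτ, hmin⟩ := isCompact_Icc.exists_isMinOn (nonempty_Icc.2 zero_le_one) hcont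
  have hpos : 0 < ‖a + τ • b‖ := norm_pos_iff.2 (hf τ).1.ne_zero
  refine ⟨f, 2 * ‖b‖ / ‖a + τ • b‖, hf0 0 rfl, hf1 1 rfl, hf, ?_, ?_, ?_⟩
  · intro t ht
    rw [le_div_iff₀ hpos]
    exact (mul_le_mul_of_nonneg_left (hmin ht) (abs_nonneg _)).trans ((hf t).1.abs_mul_norm_le b)
  · intro t h
    have h' : (-f t b) • a + (1 - f t b * t) • b = 0 := by rw [← h]; module
    obtain ⟨h1, h2⟩ := hab _ _ h'
    have h3 : f t b = 0 := by linarith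
    simp [h3] at h2
  · intro t u
    have hu : f u a = 1 - u * f u b := by
      have := (hf u).1.1
      simp at this
      linarith
    simp only [map_sub, map_smul, map_add, hu, smul_eq_mul]
    module

theorem mul_norm_residual_comm {M : E → ℝ} (hM : ∀ x, x ≠ 0 → 0 < M x)
    (hsub : ∀ e f, ContractsAlong e f → ∀ x, f x * M e ≤ M x)
    (hex : ∀ e : E, e ≠ 0 → ∃ f, ContractsAlong e f)
    {a h : E} (hah : ∀ s t : ℝ, s • a + t • h = 0 → s = 0 ∧ t = 0)
    {f g : E →L[ℝ] ℝ} (hf : ContractsAlong a f) (hg : ContractsAlong h g) :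
    M h * ‖a - g a • h‖ = M a * ‖h - f h • a‖ := by
  have hab : ∀ s t : ℝ, s • a + t • (h - a) = 0 → s = 0 ∧ t = 0 := by
    intro s t hst
    obtain ⟨h1, h2⟩ := hah (s - t) t (by rw [← hst]; module)
    exact ⟨by linarith, h2⟩
  have hne : ∀ t : ℝ, a + t • (h - a) ≠ 0 := by
    intro t ht
    have := (hab 1 t (by rw [← ht]; module)).1
    norm_num at this
  obtain ⟨F, K, hF0, hF1, hF, hK, hy, hstep⟩ := exists_contractsAlong_path (fun _ => True) hab
    (fun t => (hex _ (hne t)).imp fun _ h => ⟨h, trivial⟩) hf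
    (f₁ := g) (by simpa using hg) trivial trivial
  set y : ℝ → E := fun t => (h - a) - F t (h - a) • (a + t • (h - a)) with hydef
  have hy0 : y 0 = h - f h • a := by
    simp only [hydef, hF0, map_sub, hf.1]; module
  have hy1 : y 1 = -(a - g a • h) := by
    simp only [hydef, hF1, map_sub, hg.1]; module
  have hA := tendsto_prod_one_add_of_logSubgradient
    (G := fun t => M (a + t • (h - a))) (s := fun t => F t (h - a)) (K := K)
    (fun t _ => hM _ (hne t)) hK (by
      intro t _ u _
      have h1 := hsub _ _ (hF t).1 (a + u • (h - a))
      have h2 : F t (a + u • (h - a)) = 1 + F t (h - a) * (u - t) := by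
        have h3 := (hF t).1.1
        simp only [map_add, map_smul, smul_eq_mul] at h3 ⊢
        linear_combination h3
      rw [h2] at h1
      linarith)
  have hB := tendsto_prod_one_add_of_logSubgradient
    (G := fun t => ‖y t‖⁻¹) (s := fun t => F t (h - a)) (K := K)
    (fun t _ => inv_pos.2 (norm_pos_iff.2 (hy t))) hK (by
      intro t _ u _
      have h1 := (hF u).1.2 (y t)
      rw [hstep t u, norm_smul] at h1
      have h2 : 0 < ‖y t‖ := norm_pos_iff.2 (hy t)
      have h3 : 0 < ‖y u‖ := norm_pos_iff.2 (hy u)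
      have h4 := (mul_le_mul_of_nonneg_right (Real.le_norm_self (1 + F t (h - a) * (u - t)))
        (norm_nonneg (y u))).trans h1
      rw [inv_mul_le_iff₀ h2, ← div_eq_mul_inv, le_div_iff₀ h3]
      exact h4)
  have hEq := tendsto_nhds_unique hA hB
  have h2 : 0 < ‖y 0‖ := norm_pos_iff.2 (hy 0)
  have h3 : 0 < ‖y 1‖ := norm_pos_iff.2 (hy 1)
  have h4 : 0 < M a := hM _ hf.ne_zero
  simp only [one_smul, zero_smul, add_zero, add_sub_cancel] at hEq
  have h5 : ‖a - g a • h‖ = ‖y 1‖ := by rw [hy1, norm_neg]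
  rw [h5, ← hy0]
  field_simp at hEq
  linarith

/-- Transport of the planes `ker f` along a segment preserves the norm in the direction of a
common axis `k`. -/
theorem norm_smul_residual_add_le (hsub : ∀ (e : E) f, ContractsAlong e f → ∀ x, f x * ‖e‖ ≤ ‖x‖)
    {p q k : E} (hpq : ∀ s t : ℝ, s • p + t • q = 0 → s = 0 ∧ t = 0)
    (hex : ∀ t : ℝ, ∃ f, ContractsAlong (p + t • (q - p)) f ∧ f k = 0)
    {f g : E →L[ℝ] ℝ} (hf : ContractsAlong p f) (hg : ContractsAlong q g)
    (hfk : f k = 0) (hgk : g k = 0) (hp : ‖p‖ = 1) (hq : ‖q‖ = 1) (hfq : f q = 0) (hgp : g p = 0)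
    (α₀ β : ℝ) : ‖-(α₀ • p) + β • k‖ ≤ ‖α₀ • q + β • k‖ := by
  have hab : ∀ s t : ℝ, s • p + t • (q - p) = 0 → s = 0 ∧ t = 0 := by
    intro s t hst
    obtain ⟨h1, h2⟩ := hpq (s - t) t (by rw [← hst]; module)
    exact ⟨by linarith, h2⟩
  obtain ⟨F, K, hF0, hF1, hF, hK, hy, hstep⟩ := exists_contractsAlong_path (fun f => f k = 0) hab
    hex hf (f₁ := g) (by simpa using hg) hfk hgk
  set y : ℝ → E := fun t => (q - p) - F t (q - p) • (p + t • (q - p)) with hydef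
  have hy0 : y 0 = q := by
    simp only [hydef, hF0, map_sub, hf.1, hfq]; module
  have hy1 : y 1 = -p := by
    simp only [hydef, hF1, map_sub, hg.1, hgp]; module
  have := mul_div_mem_of_logSubgradient
    (G := fun t => ‖p + t • (q - p)‖) (s := fun t => F t (q - p)) (K := K)
    (fun t _ => norm_pos_iff.2 (hF t).1.ne_zero) hK (by
      intro t _ u _
      have h1 := hsub _ _ (hF t).1 (p + u • (q - p))
      have h2 : F t (p + u • (q - p)) = 1 + F t (q - p) * (u - t) := by
        have h3 := (hF t).1.1
        simp only [map_add, map_smul, smul_eq_mul] at h3 ⊢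
        linear_combination h3
      rw [h2] at h1
      linarith)
    (S := fun t => {α | ‖α • y t + β • k‖ ≤ ‖α₀ • q + β • k‖})
    (isClosed_le (by fun_prop) continuous_const) (by
      intro t _ u _ α hα
      have h1 := (hF u).1.2 (α • y t + β • k)
      refine le_trans (le_of_eq ?_) (h1.trans hα)
      have h2 := hstep t u
      congr 1
      calc (α * (1 + F t (q - p) * (u - t))) • y u + β • k
          = α • ((1 + F t (q - p) * (u - t)) • y u) + β • k := by rw [mul_smul]
        _ = α • (y t - F u (y t) • (p + u • (q - p))) + β • k := by rw [← h2]
        _ = _ := by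
          rw [map_add, map_smul, map_smul, (hF u).2]
          simp only [smul_eq_mul]
          module)
    (α := α₀) (by simp [hy0])
  simpa [hy1, hp, hq] using this
end Normed

section Plane

variable {E : Type*} [NormedAddCommGroup E] [NormedSpace ℝ E]

theorem linearIndependent_pair_of_contractsAlong {x y : E} {f : E →L[ℝ] ℝ}
    (hf : ContractsAlong x f) (hy : f y = 0) (hy0 : y ≠ 0) (s t : ℝ) (h : s • x + t • y = 0) :
    s = 0 ∧ t = 0 := by
  have hs : s = 0 := by simpa [hf.1, hy] using congrArg f h
  refine ⟨hs, ?_⟩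
  simpa [hs, hy0] using h

/-- If `f` contracts along `e` and functionals contracting along `e` are support functionals, then
every support functional at `e` contracts along `e`. -/
theorem contractsAlong_of_support
    (hsub : ∀ (e : E) f, ContractsAlong e f → ∀ x, f x * ‖e‖ ≤ ‖x‖)
    (hex : ∀ e : E, e ≠ 0 → ∃ f, ContractsAlong e f)
    {e : E} {φ : E →L[ℝ] ℝ} (h1 : φ e = 1) (h2 : ∀ x, φ x * ‖e‖ ≤ ‖x‖) :
    ContractsAlong e φ := by
  have he : e ≠ 0 := by rintro rfl; simp at h1
  refine ⟨h1, fun x => ?_⟩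
  set h := x - φ x • e with hh
  have hφ : φ h = 0 := by simp [hh, h1]
  by_cases h0 : h = 0
  · simp [h0]
  obtain ⟨f, hf⟩ := hex e he
  obtain ⟨g, hg⟩ := hex h h0
  have hind : ∀ s t : ℝ, s • e + t • h = 0 → s = 0 ∧ t = 0 := by
    intro s t hst
    have hs : s = 0 := by simpa [h1, hφ] using congrArg φ hst
    exact ⟨hs, by simpa [hs, h0] using hst⟩
  have hc := mul_norm_residual_comm (M := fun x : E => ‖x‖) (fun x hx => norm_pos_iff.2 hx) hsub hex
    hind hf hg
  have h3 : ‖e‖ ≤ ‖e - g e • h‖ := by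
    have := h2 (e - g e • h)
    simpa [h1, hφ] using this
  have h4 : ‖h - f h • e‖ ≤ ‖x‖ := by
    have := hf.2 x
    have h5 : h - f h • e = x - f x • e := by
      simp only [hh, map_sub, map_smul, hf.1, smul_eq_mul]; module
    rwa [h5]
  have h5 : 0 < ‖e‖ := norm_pos_iff.2 he
  have h6 : ‖h‖ * ‖e‖ ≤ ‖e‖ * ‖x‖ :=
    (mul_le_mul_of_nonneg_left h3 (norm_nonneg _)).trans
      (hc.le.trans (mul_le_mul_of_nonneg_left h4 h5.le))
  nlinarith

/-- An Auerbach triple with coordinate functionals contracting along its vectors. -/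
structure OrthoTriple (p q k : E) (f g l : E →L[ℝ] ℝ) : Prop where
  norm₁ : ‖p‖ = 1
  norm₂ : ‖q‖ = 1
  norm₃ : ‖k‖ = 1
  contracts₁ : ContractsAlong p f
  contracts₂ : ContractsAlong q g
  contracts₃ : ContractsAlong k l
  apply₁₂ : f q = 0
  apply₁₃ : f k = 0
  apply₂₁ : g p = 0
  apply₂₃ : g k = 0
  apply₃₁ : l p = 0
  apply₃₂ : l q = 0

namespace OrthoTriple

variable {p q k : E} {f g l : E →L[ℝ] ℝ}

theorem swap_neg (h : OrthoTriple p q k f g l) : OrthoTriple q (-p) k g (-f) l :=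
  ⟨h.norm₂, by simp [h.norm₁], h.norm₃, h.contracts₂, h.contracts₁.neg, h.contracts₃,
    by simp [h.apply₂₁], h.apply₂₃, by simp [h.apply₁₂], by simp [h.apply₁₃], h.apply₃₂,
    by simp [h.apply₃₁]⟩

theorem rotate (h : OrthoTriple p q k f g l) : OrthoTriple q k p g l f :=
  ⟨h.norm₂, h.norm₃, h.norm₁, h.contracts₂, h.contracts₃, h.contracts₁,
    h.apply₂₃, h.apply₂₁, h.apply₃₂, h.apply₃₁, h.apply₁₂, h.apply₁₃⟩

theorem norm_neg_smul_add_le (h : OrthoTriple p q k f g l)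
    (hsub : ∀ (e : E) f, ContractsAlong e f → ∀ x, f x * ‖e‖ ≤ ‖x‖)
    (hex : ∀ e : E, e ≠ 0 → ∃ f, ContractsAlong e f) (α β : ℝ) :
    ‖-(α • p) + β • k‖ ≤ ‖α • q + β • k‖ := by
  have hq0 := h.contracts₂.ne_zero
  have hpq := linearIndependent_pair_of_contractsAlong h.contracts₁ h.apply₁₂ hq0
  refine norm_smul_residual_add_le hsub hpq ?_ h.contracts₁ h.contracts₂ h.apply₁₃ h.apply₂₃
    h.norm₁ h.norm₂ h.apply₁₂ h.apply₂₁ α β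
  intro t
  have hne : p + t • (q - p) ≠ 0 := by
    intro ht
    have := hpq (1 - t) t (by rw [← ht]; module)
    linarith
  obtain ⟨φ, hφ⟩ := hex _ hne
  have hl : l (p + t • (q - p)) = 0 := by simp [h.apply₃₁, h.apply₃₂]
  refine ⟨φ - φ k • l, contractsAlong_of_support hsub hex ?_ fun x => ?_, ?_⟩
  · have := hφ.1
    simp only [sub_apply, smul_apply, hl, this]
    simp
  · have h1 := (hsub _ _ hφ (x - l x • k)).trans (h.contracts₃.2 x)
    refine le_trans (le_of_eq ?_) h1
    simp only [sub_apply, smul_apply, map_sub, map_smul, smul_eq_mul]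
    ring
  · simp [h.contracts₃.1]

theorem norm_smul_add_eq (h : OrthoTriple p q k f g l)
    (hsub : ∀ (e : E) f, ContractsAlong e f → ∀ x, f x * ‖e‖ ≤ ‖x‖)
    (hex : ∀ e : E, e ≠ 0 → ∃ f, ContractsAlong e f) (α β : ℝ) :
    ‖α • p + β • k‖ = ‖α • q + β • k‖ ∧ ‖-(α • q) + β • k‖ = ‖α • q + β • k‖ := by
  have h1 := fun α : ℝ => h.norm_neg_smul_add_le hsub hex α β
  have h2 := fun α : ℝ => h.swap_neg.norm_neg_smul_add_le hsub hex α β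
  have a1 := h1 α
  have a2 := h1 (-α)
  have b1 := h2 α
  have b2 := h2 (-α)
  simp only [neg_smul, smul_neg, neg_neg] at a1 a2 b1 b2
  constructor <;> linarith

theorem norm_rotation_eq (h : OrthoTriple p q k f g l)
    (hsub : ∀ (e : E) f, ContractsAlong e f → ∀ x, f x * ‖e‖ ≤ ‖x‖)
    (hex : ∀ e : E, e ≠ 0 → ∃ f, ContractsAlong e f) (α β : ℝ) :
    ‖-(β • q) + α • k‖ = ‖α • q + β • k‖ := by
  rw [(h.norm_smul_add_eq hsub hex β α).2, ← (h.norm_smul_add_eq hsub hex β α).1, add_comm,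
    ← (h.rotate.norm_smul_add_eq hsub hex α β).1, add_comm,
    ← (h.rotate.rotate.norm_smul_add_eq hsub hex β α).1, add_comm]

end OrthoTriple

end Plane

section Symmetric

variable {E : Type*} [NormedAddCommGroup E] [NormedSpace ℝ E]

theorem exists_orthoTriple (hd : Module.finrank ℝ E = 3)
    (hsub : ∀ (e : E) f, ContractsAlong e f → ∀ x, f x * ‖e‖ ≤ ‖x‖)
    (hex : ∀ e : E, e ≠ 0 → ∃ f, ContractsAlong e f)
    {h k : E} (hh : ‖h‖ = 1) (hk : ‖k‖ = 1) (hhk : ∀ t : ℝ, ‖h‖ ≤ ‖h + t • k‖)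
    (hkh : ∀ t : ℝ, ‖k‖ ≤ ‖k + t • h‖) :
    ∃ (e : E) (f g l : E →L[ℝ] ℝ), OrthoTriple e h k f g l := by
  have : FiniteDimensional ℝ E := Module.finite_of_finrank_eq_succ hd
  have : ProperSpace E := FiniteDimensional.proper ℝ E
  have hlt : Submodule.span ℝ {h, k} < ⊤ := by
    refine lt_top_iff_ne_top.2 fun htop => ?_
    classical
    have h1 := finrank_span_finset_le_card (R := ℝ) ({h, k} : Finset E)
    rw [Finset.coe_pair, Set.finrank, htop, finrank_top, hd] at h1
    have h2 : ({h, k} : Finset E).card ≤ 2 := Finset.card_le_two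
    omega
  obtain ⟨φ₀, hφ0, hker⟩ := Submodule.exists_le_ker_of_lt_top _ hlt
  set φ : E →L[ℝ] ℝ := LinearMap.toContinuousLinearMap φ₀
  have hφh : φ h = 0 := hker (Submodule.subset_span (by simp))
  have hφk : φ k = 0 := hker (Submodule.subset_span (by simp))
  obtain ⟨e₀, he₀, hmax⟩ := (isCompact_closedBall (0 : E) 1).exists_isMaxOn
    ⟨0, by simp⟩ φ.continuous.continuousOn
  have hbound : ∀ x, φ x ≤ φ e₀ * ‖x‖ := by
    intro x
    by_cases hx : x = 0
    · simp [hx]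
    have hx' : 0 < ‖x‖ := norm_pos_iff.2 hx
    have h1 : φ (‖x‖⁻¹ • x) ≤ φ e₀ := hmax (by simp [norm_smul, hx'.ne'])
    rw [map_smul, smul_eq_mul, inv_mul_le_iff₀ hx'] at h1
    linarith
  have hpos : 0 < φ e₀ := by
    obtain ⟨v, hv⟩ : ∃ v, φ v ≠ 0 := by
      by_contra! hcon
      exact hφ0 (LinearMap.ext hcon)
    have h1 := hbound v
    have h2 := hbound (-v)
    rw [map_neg, norm_neg] at h2
    have h3 : 0 ≤ ‖v‖ := norm_nonneg v
    by_contra! hcon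
    have h4 : φ e₀ * ‖v‖ ≤ 0 := mul_nonpos_of_nonpos_of_nonneg hcon h3
    exact hv (by linarith)
  have he₀le : ‖e₀‖ ≤ 1 := by simpa using he₀
  have he₀1 : ‖e₀‖ = 1 := by
    have := hbound e₀
    nlinarith
  have hfe : ContractsAlong e₀ ((φ e₀)⁻¹ • φ) := by
    refine contractsAlong_of_support hsub hex (by simp [hpos.ne']) fun x => ?_
    rw [he₀1, mul_one, smul_apply, smul_eq_mul, inv_mul_le_iff₀ hpos]
    exact hbound x
  have hk0 : k ≠ 0 := by rintro rfl; simp at hk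
  have hh0 : h ≠ 0 := by rintro rfl; simp at hh
  have hli : LinearIndependent ℝ ![e₀, h, k] := by
    rw [Fintype.linearIndependent_iff]
    intro c hc
    simp only [Fin.sum_univ_three, Matrix.cons_val] at hc
    have h0 : c 0 = 0 := by simpa [hφh, hφk, hpos.ne'] using congrArg φ hc
    rw [h0, zero_smul, zero_add] at hc
    have h1 : c 1 = 0 := by
      by_contra hne
      have := hhk (c 2 / c 1)
      have h2 : h + (c 2 / c 1) • k = (c 1)⁻¹ • (c 1 • h + c 2 • k) := by
        rw [smul_add, smul_smul, smul_smul, inv_mul_cancel₀ hne, one_smul, div_eq_inv_mul]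
      rw [h2, hc, smul_zero, norm_zero, hh] at this
      linarith
    have h2 : c 2 = 0 := by simpa [h1, hk0] using hc
    intro i
    fin_cases i <;> assumption
  let B : Module.Basis (Fin 3) ℝ E :=
    basisOfLinearIndependentOfCardEqFinrank hli (by simp [hd])
  have hB : ⇑B = ![e₀, h, k] := coe_basisOfLinearIndependentOfCardEqFinrank _ _
  have hB0 : B 0 = e₀ := by simp [hB]
  have hB1 : B 1 = h := by simp [hB]
  have hB2 : B 2 = k := by simp [hB]
  let c : Fin 3 → E →L[ℝ] ℝ := fun i => LinearMap.toContinuousLinearMap (B.coord i)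
  have hc : ∀ i j, c i (B j) = if i = j then 1 else 0 := by
    intro i j
    simp [c, Finsupp.single_apply, eq_comm]
  have hx : ∀ x, x = c 0 x • e₀ + (c 1 x • h + c 2 x • k) := by
    intro x
    have := B.sum_repr x
    rw [Fin.sum_univ_three, hB0, hB1, hB2, add_assoc] at this
    exact this.symm
  have hproj : ∀ x, ‖c 1 x • h + c 2 x • k‖ ≤ ‖x‖ := by
    intro x
    have h1 := hfe.norm_le_norm_add_smul (x := c 1 x • h + c 2 x • k) (by simp [hφh, hφk]) (c 0 x)
    rwa [add_comm _ (c 0 x • e₀), ← hx x] at h1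
  have hcoef : ∀ {u v : E}, (∀ t : ℝ, ‖u‖ ≤ ‖u + t • v‖) → ∀ a b : ℝ,
      a * ‖u‖ ≤ ‖a • u + b • v‖ := by
    intro u v huv a b
    by_cases ha : a = 0
    · simp [ha]
    have h1 := huv (b / a)
    have h2 : a • u + b • v = a • (u + (b / a) • v) := by
      rw [smul_add, smul_smul, mul_div_cancel₀ _ ha]
    rw [h2, norm_smul]
    exact mul_le_mul (Real.le_norm_self a) h1 (norm_nonneg _) (norm_nonneg _)
  have hc0 : c 0 = (φ e₀)⁻¹ • φ := by
    ext x
    have h1 : φ x = c 0 x * φ e₀ := by simpa [hφh, hφk] using congrArg φ (hx x)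
    rw [smul_apply, h1, smul_eq_mul]
    field_simp
  have e01 := hc 0 1; have e02 := hc 0 2
  have e10 := hc 1 0; have e11 := hc 1 1; have e12 := hc 1 2
  have e20 := hc 2 0; have e21 := hc 2 1; have e22 := hc 2 2
  simp only [hB0, hB1, hB2] at e01 e02 e10 e11 e12 e20 e21 e22
  refine ⟨e₀, c 0, c 1, c 2, he₀1, hh, hk, hc0 ▸ hfe, ?_, ?_, by simpa using e01,
    by simpa using e02, by simpa using e10, by simpa using e12, by simpa using e20,
    by simpa using e21⟩
  · exact contractsAlong_of_support hsub hex (by simpa using e11) fun x =>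
      (hcoef hhk _ _).trans (hproj x)
  · refine contractsAlong_of_support hsub hex (by simpa using e22) fun x => ?_
    have := hcoef hkh (c 2 x) (c 1 x)
    rw [add_comm] at this
    exact this.trans (hproj x)

theorem norm_residual_eq
    (hsub : ∀ (e : E) f, ContractsAlong e f → ∀ x, f x * ‖e‖ ≤ ‖x‖)
    (hex : ∀ e : E, e ≠ 0 → ∃ f, ContractsAlong e f)
    {x y : E} (hx : x ≠ 0) (hxy : ∀ t : ℝ, ‖x‖ ≤ ‖x + t • y‖) {f : E →L[ℝ] ℝ}
    (hf : ContractsAlong x f) : ‖y - f y • x‖ = ‖y‖ := by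
  by_cases hy : y = 0
  · simp [hy]
  obtain ⟨g, hg⟩ := hex y hy
  have hind : ∀ s t : ℝ, s • x + t • y = 0 → s = 0 ∧ t = 0 := by
    intro s t hst
    have hs : s = 0 := by
      by_contra hs
      have h1 := hxy (t / s)
      have h2 : x + (t / s) • y = s⁻¹ • (s • x + t • y) := by
        rw [smul_add, smul_smul, smul_smul, inv_mul_cancel₀ hs, one_smul, div_eq_inv_mul]
      rw [h2, hst, smul_zero, norm_zero] at h1
      exact hx (norm_le_zero_iff.1 h1)
    exact ⟨hs, by simpa [hs, hy] using hst⟩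
  have hc := mul_norm_residual_comm (M := fun x : E => ‖x‖) (fun x hx => norm_pos_iff.2 hx) hsub hex
    hind hf hg
  have h1 : ‖x - g y • y‖ ≥ 0 := norm_nonneg _
  have h2 : ‖x - g x • y‖ = ‖x‖ := by
    refine le_antisymm (hg.2 x) ?_
    have := hxy (-(g x))
    rwa [neg_smul, ← sub_eq_add_neg] at this
  rw [h2, mul_comm] at hc
  exact (mul_left_cancel₀ (norm_pos_iff.2 hx).ne' hc).symm

theorem abs_det_eq_one
    (hsub : ∀ (e : E) f, ContractsAlong e f → ∀ x, f x * ‖e‖ ≤ ‖x‖)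
    (hex : ∀ e : E, e ≠ 0 → ∃ f, ContractsAlong e f)
    {h k : E} (hh : ‖h‖ = 1) (hk : ‖k‖ = 1) (hhk : ∀ t : ℝ, ‖h‖ ≤ ‖h + t • k‖)
    (hkh : ∀ t : ℝ, ‖k‖ ≤ ‖k + t • h‖) {α β γ δ : ℝ}
    (hx : ‖α • h + β • k‖ = 1) (hy : ‖γ • h + δ • k‖ = 1)
    (hxy : ∀ t : ℝ, ‖α • h + β • k‖ ≤ ‖(α • h + β • k) + t • (γ • h + δ • k)‖) :
    |α * δ - β * γ| = 1 := by
  have hh0 : h ≠ 0 := by rintro rfl; simp at hh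
  have hk0 : k ≠ 0 := by rintro rfl; simp at hk
  have hind : ∀ s t : ℝ, s • h + t • k = 0 → s = 0 ∧ t = 0 := by
    intro s t hst
    have hs : s = 0 := by
      by_contra hs
      have h1 := hhk (t / s)
      have h2 : h + (t / s) • k = s⁻¹ • (s • h + t • k) := by
        rw [smul_add, smul_smul, smul_smul, inv_mul_cancel₀ hs, one_smul, div_eq_inv_mul]
      rw [h2, hst, smul_zero, norm_zero] at h1
      linarith
    exact ⟨hs, by simpa [hs, hk0] using hst⟩
  set x := α • h + β • k with hxdef
  set y := γ • h + δ • k with hydef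
  have hx0 : x ≠ 0 := by intro h0; rw [h0] at hx; simp at hx
  obtain ⟨f, hf⟩ := hex x hx0
  obtain ⟨g, hg⟩ := hex h hh0
  obtain ⟨l, hl⟩ := hex k hk0
  have hfy := norm_residual_eq hsub hex hx0 hxy hf
  have hgk := norm_residual_eq hsub hex hh0 hhk hg
  have hlh := norm_residual_eq hsub hex hk0 hkh hl
  have hfx := hf.1
  have hM : ∀ x : E, x ≠ 0 → 0 < ‖x‖ := fun x hx => norm_pos_iff.2 hx
  by_cases hβ : β = 0
  · have hα : α ≠ 0 := by rintro rfl; simp [hxdef, hβ] at hx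
    have hc := mul_norm_residual_comm (M := fun x : E => ‖x‖) hM hsub hex
      (a := k) (h := x) (by
        intro s t hst
        obtain ⟨h1, h2⟩ := hind (t * α) (s + t * β) (by rw [← hst, hxdef]; module)
        have h3 : t = 0 := by simpa [hα] using h1
        exact ⟨by simpa [h3] using h2, h3⟩) hl hf
    have e1 : x - l x • k = α • (h - l h • k) := by
      simp only [hxdef, map_add, map_smul, hl.1, smul_eq_mul]; module
    have e2 : α • (y - f y • x) = (α * δ - β * γ) • (k - f k • x) := by
      have : α • y = γ • x + (α * δ - β * γ) • k := by rw [hxdef, hydef]; module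
      have h2 : α * f y = γ + (α * δ - β * γ) * f k := by
        have := congrArg f this
        simpa [hfx] using this
      rw [smul_sub, this, smul_smul, h2]; module
    have e3 := congrArg norm e2
    simp only [e1, norm_smul, hlh, hfy, hx, hy, hk, hh, Real.norm_eq_abs, mul_one, one_mul]
      at hc e3
    rw [hc] at e3
    have : 0 < |α| := abs_pos.2 hα
    nlinarith
  · have hc := mul_norm_residual_comm (M := fun x : E => ‖x‖) hM hsub hex
      (a := h) (h := x) (by
        intro s t hst
        obtain ⟨h1, h2⟩ := hind (s + t * α) (t * β) (by rw [← hst, hxdef]; module)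
        have h3 : t = 0 := by simpa [hβ] using h2
        exact ⟨by simpa [h3] using h1, h3⟩) hg hf
    have e1 : x - g x • h = β • (k - g k • h) := by
      simp only [hxdef, map_add, map_smul, hg.1, smul_eq_mul]; module
    have e2 : β • (y - f y • x) = (-(α * δ - β * γ)) • (h - f h • x) := by
      have : β • y = δ • x + (-(α * δ - β * γ)) • h := by rw [hxdef, hydef]; module
      have h2 : β * f y = δ + (-(α * δ - β * γ)) * f h := by
        have := congrArg f this
        simpa [hfx] using this
      rw [smul_sub, this, smul_smul, h2]; module
    have e3 := congrArg norm e2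
    simp only [e1, norm_smul, hgk, hfy, hx, hy, hk, hh, Real.norm_eq_abs, mul_one, one_mul,
      abs_neg] at hc e3
    rw [hc] at e3
    have : 0 < |β| := abs_pos.2 hβ
    nlinarith

theorem norm_sq_eq_of_orthogonal (hd : Module.finrank ℝ E = 3)
    (hsub : ∀ (e : E) f, ContractsAlong e f → ∀ x, f x * ‖e‖ ≤ ‖x‖)
    (hex : ∀ e : E, e ≠ 0 → ∃ f, ContractsAlong e f)
    {h k : E} (hh : ‖h‖ = 1) (hk : ‖k‖ = 1) (hhk : ∀ t : ℝ, ‖h‖ ≤ ‖h + t • k‖)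
    (hkh : ∀ t : ℝ, ‖k‖ ≤ ‖k + t • h‖) (α β : ℝ) :
    ‖α • h + β • k‖ ^ 2 = α ^ 2 + β ^ 2 := by
  obtain ⟨e, f₀, g₀, l₀, hT⟩ := exists_orthoTriple hd hsub hex hh hk hhk hkh
  have hrot := fun α β => hT.norm_rotation_eq hsub hex α β
  have hcoef1 : ∀ a b : ℝ, |a| ≤ ‖a • h + b • k‖ := by
    intro a b
    have := hT.contracts₃.norm_le_norm_add_smul (x := a • h) (by simp [hT.apply₃₂]) b
    simpa [norm_smul, hh] using this
  have hcoef2 : ∀ a b : ℝ, |b| ≤ ‖a • h + b • k‖ := by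
    intro a b
    have := hT.contracts₂.norm_le_norm_add_smul (x := b • k) (by simp [hT.apply₂₃]) a
    rw [add_comm]
    simpa [norm_smul, hk] using this
  have hcpt : IsCompact {p : ℝ × ℝ | ‖p.1 • h + p.2 • k‖ ≤ 1} := by
    refine (isCompact_closedBall (0 : ℝ × ℝ) 1).of_isClosed_subset
      (isClosed_le (by fun_prop) continuous_const) fun p hp => ?_
    rw [mem_closedBall_zero_iff, Prod.norm_def]
    exact max_le ((hcoef1 _ _).trans hp) ((hcoef2 _ _).trans hp)
  obtain ⟨⟨a, b⟩, hab, hmax⟩ := hcpt.exists_isMaxOn ⟨(0, 0), by simp⟩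
    (f := fun p => p.1 ^ 2 + p.2 ^ 2) (by fun_prop)
  have hab : ‖a • h + b • k‖ ≤ 1 := hab
  set S := a ^ 2 + b ^ 2 with hS
  have hS1 : 1 ≤ S := by
    have : (1 : ℝ) ^ 2 + 0 ^ 2 ≤ S := hmax (a := ((1 : ℝ), (0 : ℝ))) (by simp [hh])
    linarith
  have hle : ∀ c d : ℝ, c ^ 2 + d ^ 2 ≤ S * ‖c • h + d • k‖ ^ 2 := by
    intro c d
    by_cases h0 : ‖c • h + d • k‖ = 0
    · have h1 := hcoef1 c d
      have h2 := hcoef2 c d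
      rw [h0] at h1 h2
      have h1 := abs_nonpos_iff.1 h1
      have h2 := abs_nonpos_iff.1 h2
      simp [h1, h2]
    set r := ‖c • h + d • k‖ with hr
    have hrpos : 0 < r := lt_of_le_of_ne (norm_nonneg _) (Ne.symm h0)
    have : (c / r) ^ 2 + (d / r) ^ 2 ≤ S := hmax (a := ((c / r : ℝ), (d / r : ℝ))) (by
      change ‖(c / r) • h + (d / r) • k‖ ≤ 1
      have : (c / r) • h + (d / r) • k = r⁻¹ • (c • h + d • k) := by
        rw [smul_add, smul_smul, smul_smul, div_eq_inv_mul, div_eq_inv_mul]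
      rw [this, norm_smul, ← hr, norm_inv, Real.norm_of_nonneg hrpos.le, inv_mul_cancel₀ h0])
    rw [div_pow, div_pow, ← add_div, div_le_iff₀ (by positivity)] at this
    exact this
  have hnab : ‖a • h + b • k‖ = 1 := by
    refine le_antisymm hab ?_
    have := hle a b
    rw [← hS] at this
    have h2 : 1 ≤ ‖a • h + b • k‖ ^ 2 := by nlinarith
    nlinarith [norm_nonneg (a • h + b • k)]
  have hnba : ‖(-b) • h + a • k‖ = 1 := by
    rw [neg_smul, hrot, hnab]
  have hdet := abs_det_eq_one hsub hex hh hk hhk hkh hnab hnba (by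
    intro t
    rw [hnab]
    have h1 := hle (a - t * b) (b + t * a)
    have h2 : (a - t * b) • h + (b + t * a) • k = a • h + b • k + t • ((-b) • h + a • k) := by
      module
    rw [h2] at h1
    have h3 : (a - t * b) ^ 2 + (b + t * a) ^ 2 = S * (1 + t ^ 2) := by rw [hS]; ring
    rw [h3] at h1
    have h4 := le_of_mul_le_mul_left h1 (by linarith)
    nlinarith [norm_nonneg (a • h + b • k + t • ((-b) • h + a • k)), sq_nonneg t])
  have hSeq : S = 1 := by
    have h1 : a * a - b * -b = S := by rw [hS]; ring
    rwa [h1, abs_of_pos (by linarith)] at hdet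
  have hunit : ∀ c d : ℝ, ‖c • h + d • k‖ = 1 → c ^ 2 + d ^ 2 = 1 := by
    intro c d hcd
    have hx0 : c • h + d • k ≠ 0 := by intro h0; rw [h0] at hcd; simp at hcd
    obtain ⟨f, hf⟩ := hex _ hx0
    have hf1 : c * f h + d * f k = 1 := by simpa using hf.1
    set y := f k • h + (-f h) • k with hy
    have hfy : f y = 0 := by simp [hy]; ring
    have hy0 : 0 < ‖y‖ := by
      refine lt_of_le_of_ne (norm_nonneg _) fun h0 => ?_
      have h1 := hcoef1 (f k) (-f h)
      have h2 := hcoef2 (f k) (-f h)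
      rw [← hy, ← h0] at h1 h2
      have h1 := abs_nonpos_iff.1 h1
      have h2 := abs_nonpos_iff.1 h2
      rw [h1, neg_eq_zero.1 h2] at hf1
      norm_num at hf1
    have hye : (f k / ‖y‖) • h + (-f h / ‖y‖) • k = ‖y‖⁻¹ • y := by
      conv_rhs => rw [hy, smul_add, smul_smul, smul_smul, ← hy]
      rw [div_eq_inv_mul, div_eq_inv_mul]
    have hyn : ‖(f k / ‖y‖) • h + (-f h / ‖y‖) • k‖ = 1 := by
      rw [hye, norm_smul, norm_inv, norm_norm, inv_mul_cancel₀ hy0.ne']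
    have hdet := abs_det_eq_one hsub hex hh hk hhk hkh hcd hyn (by
      intro t
      have h1 := hsub _ _ hf ((c • h + d • k) + t • ((f k / ‖y‖) • h + (-f h / ‖y‖) • k))
      rw [hye, map_add, hf.1, map_smul, map_smul, hfy] at h1
      rw [hye]
      simpa using h1)
    have h1 := hle c d
    have h2 := hle (f k / ‖y‖) (-f h / ‖y‖)
    rw [hcd, hSeq] at h1
    rw [hyn, hSeq] at h2
    set γ := f k / ‖y‖
    set δ := -f h / ‖y‖
    have h3 : (c * δ - d * γ) ^ 2 = 1 := by rw [← sq_abs, hdet]; norm_num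
    nlinarith [sq_nonneg (c * γ + d * δ), sq_nonneg c, sq_nonneg d, sq_nonneg γ, sq_nonneg δ]
  set r := ‖α • h + β • k‖ with hr
  by_cases h0 : r = 0
  · have h1 := hcoef1 α β
    have h2 := hcoef2 α β
    rw [← hr, h0] at h1 h2
    have h1 := abs_nonpos_iff.1 h1
    have h2 := abs_nonpos_iff.1 h2
    simp [h0, h1, h2]
  have hrpos : 0 < r := lt_of_le_of_ne (norm_nonneg _) (Ne.symm h0)
  have := hunit (α / r) (β / r) (by
    have : (α / r) • h + (β / r) • k = r⁻¹ • (α • h + β • k) := by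
      rw [smul_add, smul_smul, smul_smul, div_eq_inv_mul, div_eq_inv_mul]
    rw [this, norm_smul, ← hr, norm_inv, Real.norm_of_nonneg hrpos.le, inv_mul_cancel₀ h0])
  rw [div_pow, div_pow, ← add_div, div_eq_one_iff_eq (by positivity)] at this
  exact this.symm

theorem parallelogram_of_support (hd : Module.finrank ℝ E = 3)
    (hsub : ∀ (e : E) f, ContractsAlong e f → ∀ x, f x * ‖e‖ ≤ ‖x‖)
    (hex : ∀ e : E, e ≠ 0 → ∃ f, ContractsAlong e f) (x y : E) :
    ‖x + y‖ ^ 2 + ‖x - y‖ ^ 2 = 2 * (‖x‖ ^ 2 + ‖y‖ ^ 2) := by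
  by_cases hx : x = 0
  · simp [hx]; ring
  obtain ⟨f, hf⟩ := hex x hx
  set w := y - f y • x with hw
  have hy : y = f y • x + w := by rw [hw]; abel
  have hfw : f w = 0 := by simp [hw, hf.1]
  have hxpos : 0 < ‖x‖ := norm_pos_iff.2 hx
  by_cases hw0 : w = 0
  · rw [hw0, add_zero] at hy
    have h1 : x + y = (1 + f y) • x := by
      conv_lhs => rw [hy]
      module
    have h2 : x - y = (1 - f y) • x := by
      conv_lhs => rw [hy]
      module
    have h3 : ‖y‖ = |f y| * ‖x‖ := by conv_lhs => rw [hy, norm_smul, Real.norm_eq_abs]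
    rw [h1, h2, h3, norm_smul, norm_smul, mul_pow, mul_pow, mul_pow]
    simp only [Real.norm_eq_abs, sq_abs]
    ring
  have hwpos : 0 < ‖w‖ := norm_pos_iff.2 hw0
  have key : ∀ a b : ℝ, ‖a • x + b • w‖ ^ 2 = (a * ‖x‖) ^ 2 + (b * ‖w‖) ^ 2 := by
    intro a b
    have := norm_sq_eq_of_orthogonal hd hsub hex (h := ‖x‖⁻¹ • x) (k := ‖w‖⁻¹ • w)
      (by simp [norm_smul, hxpos.ne']) (by simp [norm_smul, hwpos.ne'])
      (by
        intro t
        have h1 := hsub _ _ hf (‖x‖⁻¹ • x + t • ‖w‖⁻¹ • w)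
        have h2 : f (‖x‖⁻¹ • x + t • ‖w‖⁻¹ • w) = ‖x‖⁻¹ := by simp [hf.1, hfw]
        rw [h2] at h1
        simpa [norm_smul] using h1)
      (by
        intro t
        have h1 := hf.norm_le_norm_add_smul (x := ‖w‖⁻¹ • w) (by simp [hfw]) (t * ‖x‖⁻¹)
        rwa [mul_smul] at h1)
      (a * ‖x‖) (b * ‖w‖)
    rwa [smul_smul, smul_smul, mul_assoc, mul_assoc, mul_inv_cancel₀ hxpos.ne',
      mul_inv_cancel₀ hwpos.ne', mul_one, mul_one] at this
  have k1 := key (1 + f y) 1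
  have k2 := key (1 - f y) (-1)
  have k3 := key (f y) 1
  have h1 : x + y = (1 + f y) • x + (1 : ℝ) • w := by rw [hw]; module
  have h2 : x - y = (1 - f y) • x + (-1 : ℝ) • w := by rw [hw]; module
  have h3 : f y • x + (1 : ℝ) • w = y := by rw [hw]; module
  rw [h3] at k3
  rw [h1, h2, k1, k2, k3]
  ring

end Symmetric

section Volume

variable {E : Type*} [NormedAddCommGroup E] [NormedSpace ℝ E]

/-- Along a path joining a vector to its opposite, some contracting functional kills `x`. -/
theorem exists_contractsAlong_apply_eq_zero [FiniteDimensional ℝ E]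
    (hex : ∀ e : E, e ≠ 0 → ∃ f, ContractsAlong e f) {p : ℝ → E} (hp : Continuous p)
    (hp0 : ∀ t, p t ≠ 0) (hanti : p 1 = -p 0) (x : E) :
    ∃ t f, ContractsAlong (p t) f ∧ f x = 0 := by
  have : ProperSpace (E →L[ℝ] ℝ) := FiniteDimensional.proper ℝ _
  obtain ⟨t₀, -, ht₀⟩ := isCompact_Icc.exists_isMinOn (f := fun t => ‖p t‖)
    (nonempty_Icc.2 (zero_le_one (α := ℝ))) (by fun_prop)
  set m := ‖p t₀‖ with hm
  have hmpos : 0 < m := norm_pos_iff.2 (hp0 t₀)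
  have hbd : ∀ t ∈ Icc (0 : ℝ) 1, ∀ f, ContractsAlong (p t) f → ‖f‖ ≤ 2 / m := by
    intro t ht f hf
    refine f.opNorm_le_bound (by positivity) fun y => ?_
    have h1 := hf.abs_mul_norm_le y
    have h2 : m ≤ ‖p t‖ := ht₀ ht
    rw [div_mul_eq_mul_div, le_div_iff₀ hmpos, Real.norm_eq_abs]
    exact (mul_le_mul_of_nonneg_left h2 (abs_nonneg _)).trans h1
  have hclosed : ∀ s : ℝ,
      IsClosed {t | t ∈ Icc (0 : ℝ) 1 ∧ ∃ f, ContractsAlong (p t) f ∧ 0 ≤ s * f x} := by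
    intro s
    have hK : IsCompact {q : ℝ × (E →L[ℝ] ℝ) | q ∈ Icc (0 : ℝ) 1 ×ˢ Metric.closedBall 0 (2 / m) ∧
        ContractsAlong (p q.1) q.2 ∧ 0 ≤ s * q.2 x} := by
      refine (isCompact_Icc.prod (isCompact_closedBall _ _)).of_isClosed_subset ?_
        fun q hq => hq.1
      refine (isClosed_Icc.prod Metric.isClosed_closedBall).inter (IsClosed.inter ?_ ?_)
      · have heq : {q : ℝ × (E →L[ℝ] ℝ) | ContractsAlong (p q.1) q.2} =
            {q | q.2 (p q.1) = 1} ∩ ⋂ y, {q | ‖y - q.2 y • p q.1‖ ≤ ‖y‖} := by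
          ext q
          simp [ContractsAlong]
        have hcl : IsClosed {q : ℝ × (E →L[ℝ] ℝ) | ContractsAlong (p q.1) q.2} := by
          rw [heq]
          exact (isClosed_eq (by fun_prop) continuous_const).inter
            (isClosed_iInter fun y => isClosed_le (by fun_prop) continuous_const)
        exact hcl
      · exact isClosed_le (f := fun _ : ℝ × (E →L[ℝ] ℝ) => (0 : ℝ))
          (g := fun q => s * q.2 x) continuous_const (by fun_prop)
    convert (hK.image continuous_fst).isClosed using 1
    ext t
    constructor
    · rintro ⟨ht, f, hf, hfx⟩
      exact ⟨(t, f), ⟨⟨ht, by simpa using hbd t ht f hf⟩, hf, hfx⟩, rfl⟩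
    · rintro ⟨⟨t', f⟩, ⟨⟨ht, -⟩, hf, hfx⟩, rfl⟩
      exact ⟨ht, f, hf, hfx⟩
  obtain ⟨f₀, hf₀⟩ := hex (p 0) (hp0 0)
  have hf₁ : ContractsAlong (p 1) (-f₀) := hanti ▸ hf₀.neg
  have h0 : (0 : ℝ) ∈ Icc (0 : ℝ) 1 := by simp
  have h1 : (1 : ℝ) ∈ Icc (0 : ℝ) 1 := by simp
  have hmeet := isPreconnected_closed_iff.1 (isPreconnected_Icc (a := (0 : ℝ)) (b := 1)) _ _
    (hclosed 1) (hclosed (-1)) (by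
      intro t ht
      obtain ⟨f, hf⟩ := hex (p t) (hp0 t)
      rcases le_total 0 (f x) with hs | hs
      · exact Or.inl ⟨ht, f, hf, by simpa using hs⟩
      · exact Or.inr ⟨ht, f, hf, by simpa using hs⟩)
    (by
      rcases le_total 0 (f₀ x) with hs | hs
      · exact ⟨0, h0, h0, f₀, hf₀, by simpa using hs⟩
      · exact ⟨1, h1, h1, -f₀, hf₁, by simpa using hs⟩)
    (by
      rcases le_total 0 (f₀ x) with hs | hs
      · exact ⟨1, h1, h1, -f₀, hf₁, by simpa using hs⟩
      · exact ⟨0, h0, h0, f₀, hf₀, by simpa using hs⟩)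
  obtain ⟨t, -, ⟨-, f, hf, hfx⟩, -, g, hg, hgx⟩ := hmeet
  have hfx : 0 ≤ f x := by simpa using hfx
  have hgx : g x ≤ 0 := by simpa using hgx
  by_cases hgx0 : g x = 0
  · exact ⟨t, g, hg, hgx0⟩
  have hlt : 0 < f x - g x := by
    have := lt_of_le_of_ne hgx hgx0
    linarith
  set a := -g x / (f x - g x) with ha
  set b := f x / (f x - g x) with hb
  have ha0 : 0 ≤ a := div_nonneg (by linarith) hlt.le
  have hb0 : 0 ≤ b := div_nonneg hfx hlt.le
  have hab : a + b = 1 := by rw [ha, hb]; field_simp; ring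
  refine ⟨t, a • f + b • g, ⟨by simp [hf.1, hg.1, hab], fun y => ?_⟩, ?_⟩
  · have h2 : y - (a • f + b • g) y • p t = a • (y - f y • p t) + b • (y - g y • p t) := by
      have : a = 1 - b := by linarith
      simp only [add_apply, smul_apply, smul_eq_mul]
      rw [this]
      module
    rw [h2]
    calc ‖a • (y - f y • p t) + b • (y - g y • p t)‖
        ≤ a * ‖y - f y • p t‖ + b * ‖y - g y • p t‖ := by
          refine (norm_add_le _ _).trans_eq ?_
          rw [norm_smul, norm_smul, Real.norm_of_nonneg ha0, Real.norm_of_nonneg hb0]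
      _ ≤ a * ‖y‖ + b * ‖y‖ := by gcongr <;> [exact hf.2 y; exact hg.2 y]
      _ = ‖y‖ := by rw [← add_mul, hab, one_mul]
  · simp only [add_apply, smul_apply, smul_eq_mul, ha, hb]
    field_simp
    ring

theorem exists_volume_form (hd : Module.finrank ℝ E = 3) :
    ∃ D : E → E → E → ℝ, (Continuous fun q : E × E × E => D q.1 q.2.1 q.2.2) ∧
      (∀ (c : ℝ) h k e, D (c • h) k e = c * D h k e) ∧
      (∀ (c : ℝ) h k e, D h (c • k) e = c * D h k e) ∧
      (∀ (c : ℝ) h k e, D h k (c • e) = c * D h k e) ∧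
      (∀ (s t : ℝ) h k e, D (h - s • e) (k - t • e) e = D h k e) ∧
      (∀ h k x y, D h k (x + y) = D h k x + D h k y) ∧
      (∀ f : E →L[ℝ] ℝ, f ≠ 0 → ∀ h k e, f h = 0 → f k = 0 → f e = 0 → D h k e = 0) ∧
      ∀ e ≠ 0, ∃ h k, D h k e ≠ 0 := by
  have : FiniteDimensional ℝ E := Module.finite_of_finrank_eq_succ hd
  let B : Module.Basis (Fin 3) ℝ E := Module.finBasisOfFinrankEq ℝ E hd
  let c : Fin 3 → E →L[ℝ] ℝ := fun i => LinearMap.toContinuousLinearMap (B.coord i)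
  have hc : ∀ i j, c i (B j) = if i = j then 1 else 0 := by
    intro i j
    simp [c, Finsupp.single_apply, eq_comm]
  have hx : ∀ x, x = c 0 x • B 0 + c 1 x • B 1 + c 2 x • B 2 := by
    intro x
    have := B.sum_repr x
    rw [Fin.sum_univ_three] at this
    exact this.symm
  refine ⟨fun h k e => c 0 h * (c 1 k * c 2 e - c 2 k * c 1 e)
    - c 1 h * (c 0 k * c 2 e - c 2 k * c 0 e) + c 2 h * (c 0 k * c 1 e - c 1 k * c 0 e),
    by fun_prop, ?_, ?_, ?_, ?_, ?_, ?_, ?_⟩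
  iterate 3
    · intro s h k e
      simp only [map_smul, smul_eq_mul]
      ring
  · intro s t h k e
    simp only [map_smul, map_sub, smul_eq_mul]
    ring
  · intro h k x y
    simp only [map_add]
    ring
  · intro f hf h k e hh hk he
    have hfx : ∀ x, f x = c 0 x * f (B 0) + c 1 x * f (B 1) + c 2 x * f (B 2) := by
      intro x
      simpa using congrArg f (hx x)
    rw [hfx] at hh hk he
    by_contra hne
    have e0 : f (B 0) = 0 := by
      refine (mul_eq_zero.1 ?_).resolve_left hne
      linear_combination (c 1 k * c 2 e - c 2 k * c 1 e) * hh
        - (c 1 h * c 2 e - c 2 h * c 1 e) * hk + (c 1 h * c 2 k - c 2 h * c 1 k) * he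
    have e1 : f (B 1) = 0 := by
      refine (mul_eq_zero.1 ?_).resolve_left hne
      linear_combination -(c 0 k * c 2 e - c 2 k * c 0 e) * hh
        + (c 0 h * c 2 e - c 2 h * c 0 e) * hk - (c 0 h * c 2 k - c 2 h * c 0 k) * he
    have e2 : f (B 2) = 0 := by
      refine (mul_eq_zero.1 ?_).resolve_left hne
      linear_combination (c 0 k * c 1 e - c 1 k * c 0 e) * hh
        - (c 0 h * c 1 e - c 1 h * c 0 e) * hk + (c 0 h * c 1 k - c 1 h * c 0 k) * he
    exact hf (ContinuousLinearMap.ext fun x => by simp [hfx x, e0, e1, e2])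
  · intro e he
    by_contra! hcon
    have h0 := hcon (B 1) (B 2)
    have h1 := hcon (B 0) (B 2)
    have h2 := hcon (B 0) (B 1)
    simp [hc] at h0 h1 h2
    exact he (by rw [hx e, h0, h1, h2]; simp)

theorem exists_two_dim_of_ker (hd : Module.finrank ℝ E = 3) (f : E →L[ℝ] ℝ) :
    ∃ u v : E, f u = 0 ∧ f v = 0 ∧ ∀ s t : ℝ, s • u + t • v = 0 → s = 0 ∧ t = 0 := by
  have : FiniteDimensional ℝ E := Module.finite_of_finrank_eq_succ hd
  have h1 := LinearMap.finrank_range_add_finrank_ker (f : E →ₗ[ℝ] ℝ)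
  have h2 := Submodule.finrank_le (LinearMap.range (f : E →ₗ[ℝ] ℝ))
  rw [Module.finrank_self] at h2
  have h3 : 2 ≤ Module.finrank ℝ (LinearMap.ker (f : E →ₗ[ℝ] ℝ)) := by omega
  obtain ⟨w, hw⟩ := exists_linearIndependent_of_le_finrank h3
  refine ⟨w 0, w 1, (w 0).2, (w 1).2, fun s t hst => ?_⟩
  have := LinearIndependent.pair_iff.1 (by
    convert hw using 1
    ext i
    fin_cases i <;> rfl : LinearIndependent ℝ ![w 0, w 1]) s t (Subtype.ext (by simpa using hst))
  exact this

theorem mul_norm_le_of_exists_contractsAlong (hd : Module.finrank ℝ E = 3)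
    (hex : ∀ e : E, e ≠ 0 → ∃ f, ContractsAlong e f)
    (e : E) (f : E →L[ℝ] ℝ) (hf : ContractsAlong e f) (x : E) : f x * ‖e‖ ≤ ‖x‖ := by
  have : FiniteDimensional ℝ E := Module.finite_of_finrank_eq_succ hd
  have : ProperSpace E := FiniteDimensional.proper ℝ E
  obtain ⟨D, hDc, hD1, hD2, hD3, hDsub, hDadd, hDker, hDne⟩ := exists_volume_form hd
  have hball := isCompact_closedBall (0 : E) 1
  have hmax : ∀ x, ∃ h k, ‖h‖ ≤ 1 ∧ ‖k‖ ≤ 1 ∧ ∀ h₁ k₁, ‖h₁‖ ≤ 1 → ‖k₁‖ ≤ 1 →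
      D h₁ k₁ x ≤ D h k x := by
    intro x
    obtain ⟨⟨h, k⟩, hhk, hm⟩ := (hball.prod hball).exists_isMaxOn ⟨(0, 0), by simp⟩
      (f := fun q => D q.1 q.2 x)
      (hDc.comp (f := fun q : E × E => (q.1, q.2, x)) (by fun_prop)).continuousOn
    refine ⟨h, k, by simpa using hhk.1, by simpa using hhk.2, fun h₁ k₁ hh₁ hk₁ => ?_⟩
    exact hm (a := (h₁, k₁)) ⟨by simpa using hh₁, by simpa using hk₁⟩
  choose H K hH hK hHK using hmax
  set M : E → ℝ := fun x => D (H x) (K x) x with hMdef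
  have hM : ∀ x h k, ‖h‖ ≤ 1 → ‖k‖ ≤ 1 → D h k x ≤ M x := fun x h k => hHK x h k
  have hMpos : ∀ x, x ≠ 0 → 0 < M x := by
    intro x hx
    obtain ⟨h, k, hne⟩ := hDne x hx
    have hz : ∀ y : E, ‖‖y‖⁻¹ • y‖ ≤ 1 := by
      intro y
      rw [norm_smul, norm_inv, norm_norm]
      exact inv_mul_le_one
    have h1 := hM x (‖h‖⁻¹ • h) (‖k‖⁻¹ • k) (hz h) (hz k)
    have h2 := hM x ((-1 : ℝ) • ‖h‖⁻¹ • h) (‖k‖⁻¹ • k) (by simpa using hz h) (hz k)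
    rw [hD1, hD1, hD2] at h2
    rw [hD1, hD2] at h1
    have hh0 : ‖h‖ ≠ 0 := by
      intro h0
      have := hD1 0 h k x
      rw [zero_smul, zero_mul, ← norm_eq_zero.1 h0] at this
      exact hne this
    have hk0 : ‖k‖ ≠ 0 := by
      intro h0
      have := hD2 0 h k x
      rw [zero_smul, zero_mul, ← norm_eq_zero.1 h0] at this
      exact hne this
    have h3 : ‖h‖⁻¹ * (‖k‖⁻¹ * D h k x) ≠ 0 :=
      mul_ne_zero (inv_ne_zero hh0) (mul_ne_zero (inv_ne_zero hk0) hne)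
    rcases lt_or_gt_of_ne h3 with h4 | h4 <;> linarith
  have hMsub : ∀ e f, ContractsAlong e f → ∀ x, f x * M e ≤ M x := by
    intro e f hf x
    have hf0 : f ≠ 0 := by rintro rfl; simpa using hf.1
    have h1 := hM x (H e - f (H e) • e) (K e - f (K e) • e) ((hf.2 _).trans (hH e))
      ((hf.2 _).trans (hK e))
    have h2 : x = f x • e + (x - f x • e) := by abel
    have h3 : D (H e - f (H e) • e) (K e - f (K e) • e) x = f x * M e := by
      conv_lhs => rw [h2]
      rw [hDadd, hD3, hDsub, hDker f hf0 _ _ (x - f x • e) (by simp [hf.1]) (by simp [hf.1])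
        (by simp [hf.1]), add_zero]
    rwa [h3] at h1
  obtain ⟨⟨h₀, k₀, e₀⟩, hhke, hm⟩ := (hball.prod (hball.prod hball)).exists_isMaxOn
    ⟨(0, 0, 0), by simp⟩ hDc.continuousOn
  set R := D h₀ k₀ e₀ with hR
  have hMR : ∀ x, M x ≤ R * ‖x‖ := by
    intro x
    have h1 : D (H x) (K x) (‖x‖⁻¹ • x) ≤ R := hm (a := (H x, K x, ‖x‖⁻¹ • x))
      ⟨by simpa using hH x, by simpa using hK x, by
        rw [mem_closedBall_zero_iff, norm_smul, norm_inv, norm_norm]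
        exact inv_mul_le_one⟩
    by_cases hx : x = 0
    · have := hD3 0 (H x) (K x) x
      rw [zero_smul, zero_mul] at this
      rw [hx] at this
      simp [hMdef, hx, this]
    have hx' : 0 < ‖x‖ := norm_pos_iff.2 hx
    rw [hD3, inv_mul_le_iff₀ hx'] at h1
    rw [mul_comm]
    exact h1
  have hn₀ : ‖h₀‖ ≤ 1 ∧ ‖k₀‖ ≤ 1 ∧ ‖e₀‖ ≤ 1 := by simpa using hhke
  have hRpos : 0 < R := by
    have h1 := hMR e
    have h2 := hMpos e hf.ne_zero
    exact pos_of_mul_pos_left (h2.trans_le h1) (norm_nonneg _)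
  have hRe₀ : R ≤ M e₀ := hM e₀ h₀ k₀ hn₀.1 hn₀.2.1
  have he₀ : M e₀ = R * ‖e₀‖ := by
    refine le_antisymm (hMR e₀) (le_trans ?_ hRe₀)
    exact mul_le_of_le_one_right hRpos.le hn₀.2.2
  have he₀ne : e₀ ≠ 0 := by
    rintro rfl
    rw [norm_zero, mul_zero] at he₀
    linarith
  have hspread : ∀ (a : E) (φ : E →L[ℝ] ℝ) (h : E), ContractsAlong a φ → φ h = 0 → h ≠ 0 →
      M a = R * ‖a‖ → M h = R * ‖h‖ := by
    intro a φ h hφ hφh hh ha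
    obtain ⟨g, hg⟩ := hex h hh
    have hind : ∀ s t : ℝ, s • a + t • h = 0 → s = 0 ∧ t = 0 := by
      intro s t hst
      have hs : s = 0 := by simpa [hφ.1, hφh] using congrArg φ hst
      exact ⟨hs, by simpa [hs, hh] using hst⟩
    have h1 := mul_norm_residual_comm hMpos hMsub hex hind hφ hg
    rw [hφh, zero_smul, sub_zero, ha] at h1
    refine le_antisymm (hMR h) ?_
    have h2 := mul_le_mul_of_nonneg_left (hg.2 a) (hMpos h hh).le
    have h3 : 0 < ‖a‖ := norm_pos_iff.2 hφ.ne_zero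
    refine le_of_mul_le_mul_right ?_ h3
    linarith
  have hMeq : ∀ x, x ≠ 0 → M x = R * ‖x‖ := by
    intro x hx
    obtain ⟨f₀, hf₀⟩ := hex e₀ he₀ne
    obtain ⟨u, v, hu, hv, huv⟩ := exists_two_dim_of_ker hd f₀
    have hp0 : ∀ t : ℝ, Real.cos (Real.pi * t) • u + Real.sin (Real.pi * t) • v ≠ 0 := by
      intro t h0
      obtain ⟨h1, h2⟩ := huv _ _ h0
      have := Real.sin_sq_add_cos_sq (Real.pi * t)
      simp [h1, h2] at this
    obtain ⟨t, g, hg, hgx⟩ := exists_contractsAlong_apply_eq_zero hex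
      (p := fun t : ℝ => Real.cos (Real.pi * t) • u + Real.sin (Real.pi * t) • v)
      (by fun_prop) hp0 (by simp) x
    exact hspread _ g x hg hgx hx (hspread e₀ f₀ _ hf₀ (by simp [hu, hv]) (hp0 t) he₀)
  have h1 := hMsub e f hf x
  rw [hMeq e hf.ne_zero] at h1
  refine le_of_mul_le_mul_left ?_ hRpos
  have := hMR x
  linarith

end Volume

section Transitive

variable {X : Type*} [NormedAddCommGroup X] [NormedSpace ℝ X]

theorem exists_sub_apply_eq_smul {Z : Submodule ℝ X} {P : X →L[ℝ] X}
    (hZ : Module.rank ℝ (X ⧸ Z) = 1) (hrange : LinearMap.range (P : X →ₗ[ℝ] X) = Z)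
    (hP : ∀ z ∈ Z, P z = z) :
    ∃ u : X, ‖u‖ = 1 ∧ P u = 0 ∧ ∀ x, ∃ c : ℝ, x - P x = c • u := by
  have hmem : ∀ x, P x ∈ Z := fun x => hrange ▸ LinearMap.mem_range_self (P : X →ₗ[ℝ] X) x
  obtain ⟨q, hq0, hq⟩ := finrank_eq_one_iff'.1
    (Module.finrank_eq_of_rank_eq (n := 1) (by simpa using hZ))
  obtain ⟨z, rfl⟩ := Submodule.mkQ_surjective Z q
  set v := z - P z with hv
  have hPv : P v = 0 := by rw [hv, map_sub, hP _ (hmem z), sub_self]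
  have hv0 : ‖v‖ ≠ 0 := by
    intro h0
    have h1 : z = P z := sub_eq_zero.1 (norm_eq_zero.1 h0)
    refine hq0 ((Submodule.Quotient.mk_eq_zero Z).2 ?_)
    rw [h1]
    exact hmem z
  refine ⟨‖v‖⁻¹ • v, by rw [norm_smul, norm_inv, norm_norm, inv_mul_cancel₀ hv0],
    by rw [map_smul, hPv, smul_zero], fun x => ?_⟩
  obtain ⟨c, hc⟩ := hq (Submodule.mkQ Z x)
  refine ⟨c * ‖v‖, ?_⟩
  have h1 : x - c • z ∈ Z := by
    rw [← Submodule.Quotient.mk_eq_zero]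
    simpa [sub_eq_zero] using hc.symm
  have h2 := hP _ h1
  rw [map_sub, map_smul] at h2
  rw [smul_smul, mul_assoc, mul_inv_cancel₀ hv0, mul_one, hv, smul_sub]
  rw [sub_eq_sub_iff_add_eq_add] at h2 ⊢
  rw [← h2, add_comm]

theorem exists_almost_contractsAlong
    (hAT : ∀ x y : X, ‖x‖ = 1 → ‖y‖ = 1 → ∀ ε > 0, ∃ T : X ≃L[ℝ] X,
      T x = y ∧ ‖(T : X →L[ℝ] X)‖ ≤ 1 + ε ∧ ‖(T.symm : X →L[ℝ] X)‖ ≤ 1 + ε)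
    (hproj : ∀ ε > 0, ∃ (Z : Submodule ℝ X) (P : X →L[ℝ] X),
      Module.rank ℝ (X ⧸ Z) = 1 ∧ LinearMap.range (P : X →ₗ[ℝ] X) = Z ∧
      (∀ z ∈ Z, P z = z) ∧ ‖P‖ ≤ 1 + ε) {e : X} (he : ‖e‖ = 1) {ε : ℝ} (hε : 0 < ε) :
    ∃ f : X →L[ℝ] ℝ, f e = 1 ∧ ‖f‖ ≤ 1 + (1 + ε) ^ 3 ∧
      ∀ x, ‖x - f x • e‖ ≤ (1 + ε) ^ 3 * ‖x‖ := by
  obtain ⟨Z, P, hZ, hrange, hP, hPn⟩ := hproj ε hε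
  obtain ⟨u, hu, hPu, hline⟩ := exists_sub_apply_eq_smul hZ hrange hP
  obtain ⟨T, hT, hTn, hTs⟩ := hAT u e hu he ε hε
  obtain ⟨g, hg, hge⟩ := exists_dual_vector ℝ e (by rw [he]; exact one_ne_zero)
  set Q : X →L[ℝ] X := (T : X →L[ℝ] X) ∘L P ∘L (T.symm : X →L[ℝ] X) with hQ
  have hQx : ∀ x, Q x = T (P (T.symm x)) := fun x => rfl
  have hTe : T.symm e = u := by rw [← hT, T.symm_apply_apply]
  have hQe : Q e = 0 := by rw [hQx, hTe, hPu, map_zero]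
  have hge1 : g e = 1 := by rw [hge, he]; simp
  have hQn : ∀ x, ‖Q x‖ ≤ (1 + ε) ^ 3 * ‖x‖ := by
    intro x
    calc ‖Q x‖ ≤ (1 + ε) * ‖P (T.symm x)‖ := (T : X →L[ℝ] X).le_of_opNorm_le hTn _
      _ ≤ (1 + ε) * ((1 + ε) * ‖T.symm x‖) := by
          gcongr
          exact P.le_of_opNorm_le hPn _
      _ ≤ (1 + ε) * ((1 + ε) * ((1 + ε) * ‖x‖)) := by
          gcongr
          exact (T.symm : X →L[ℝ] X).le_of_opNorm_le hTs _
      _ = (1 + ε) ^ 3 * ‖x‖ := by ring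
  refine ⟨g ∘L (ContinuousLinearMap.id ℝ X - Q), by simp [hQe, hge1], ?_, fun x => ?_⟩
  · refine ContinuousLinearMap.opNorm_le_bound _ (by positivity) fun x => ?_
    calc ‖g (x - Q x)‖ ≤ 1 * ‖x - Q x‖ := g.le_of_opNorm_le hg.le _
      _ ≤ 1 * (‖x‖ + (1 + ε) ^ 3 * ‖x‖) := by
          gcongr
          exact (norm_sub_le _ _).trans (by gcongr; exact hQn x)
      _ = (1 + (1 + ε) ^ 3) * ‖x‖ := by ring
  · obtain ⟨c, hc⟩ := hline (T.symm x)
    have h1 : x - Q x = c • e := by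
      have := congrArg T hc
      rwa [map_sub, map_smul, T.apply_symm_apply, ← hQx, hT] at this
    have h2 : x - (g ∘L (ContinuousLinearMap.id ℝ X - Q)) x • e = Q x := by
      have h3 : (g ∘L (ContinuousLinearMap.id ℝ X - Q)) x = g (x - Q x) := rfl
      rw [h3, h1, map_smul, hge1, smul_eq_mul, mul_one, ← h1]
      abel
    rw [h2]
    exact hQn x

theorem exists_contractsAlong_subspace (E : Submodule ℝ X) [FiniteDimensional ℝ E]
    (h : ∀ e : X, ‖e‖ = 1 → ∀ ε > 0, ∃ f : X →L[ℝ] ℝ, f e = 1 ∧ ‖f‖ ≤ 1 + (1 + ε) ^ 3 ∧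
      ∀ x, ‖x - f x • e‖ ≤ (1 + ε) ^ 3 * ‖x‖) (e : E) (he : e ≠ 0) :
    ∃ f, ContractsAlong e f := by
  have : ProperSpace (E →L[ℝ] ℝ) := FiniteDimensional.proper ℝ (E →L[ℝ] ℝ)
  have hen : ‖e‖ ≠ 0 := norm_ne_zero_iff.2 he
  set u : E := ‖e‖⁻¹ • e with hu
  have hu1 : ‖(u : X)‖ = 1 := by
    rw [Submodule.norm_coe, hu, norm_smul, norm_inv, norm_norm, inv_mul_cancel₀ hen]
  choose F hF1 hF2 hF3 using fun n : ℕ => h u hu1 (1 / ((n : ℝ) + 1)) Nat.one_div_pos_of_nat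
  have hle : ∀ n : ℕ, 1 / ((n : ℝ) + 1) ≤ 1 := by
    intro n
    rw [div_le_one (by positivity)]
    linarith [(Nat.cast_nonneg n : (0 : ℝ) ≤ n)]
  have hbd : ∀ n, (F n ∘L E.subtypeL) ∈ Metric.closedBall (0 : E →L[ℝ] ℝ) 9 := by
    intro n
    refine (mem_closedBall_zero_iff (E := E →L[ℝ] ℝ)).2 ?_
    refine ContinuousLinearMap.opNorm_le_bound _ (by norm_num) fun x => ?_
    refine (F n).le_of_opNorm_le ((hF2 n).trans ?_) (x : X)
    have : (1 + 1 / ((n : ℝ) + 1)) ^ 3 ≤ (1 + 1) ^ 3 := by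
      gcongr
      exact hle n
    linarith
  obtain ⟨f, -, φ, hφ, hlim⟩ := (isCompact_closedBall _ _).tendsto_subseq hbd
  have hpt : ∀ x : E, Tendsto (fun n => F (φ n) x) atTop (𝓝 (f x)) := fun x =>
    ((ContinuousLinearMap.apply ℝ ℝ x).continuous.tendsto f).comp hlim
  have hfu : f u = 1 := tendsto_nhds_unique (hpt u) (by simp [hF1])
  have hfc : ∀ x, ‖x - f x • u‖ ≤ ‖x‖ := by
    intro x
    have h1 : Tendsto (fun n => ‖(x : X) - F (φ n) x • (u : X)‖) atTop
        (𝓝 ‖(x : X) - f x • (u : X)‖) := (((hpt x).smul_const _).const_sub _).norm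
    have h2 : Tendsto (fun n => (1 + 1 / ((φ n : ℝ) + 1)) ^ 3 * ‖(x : X)‖) atTop
        (𝓝 ((1 + 0) ^ 3 * ‖(x : X)‖)) :=
      (((tendsto_one_div_add_atTop_nhds_zero_nat.comp hφ.tendsto_atTop).const_add 1).pow
        3).mul_const _
    simpa using le_of_tendsto_of_tendsto' h1 h2 fun n => hF3 (φ n) x
  have heu : e = ‖e‖ • u := by rw [hu, smul_smul, mul_inv_cancel₀ hen, one_smul]
  refine ⟨‖e‖⁻¹ • f, ?_, fun x => ?_⟩
  · rw [smul_apply]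
    nth_rewrite 2 [heu]
    rw [map_smul, hfu, smul_eq_mul, smul_eq_mul, mul_one, inv_mul_cancel₀ hen]
  · have : (‖e‖⁻¹ • f) x • e = f x • u := by
      rw [hu, smul_smul, smul_apply, smul_eq_mul, mul_comm]
    rw [this]
    exact hfc x

theorem exists_submodule_finrank_eq_three (hdim : 3 ≤ Module.rank ℝ X) (x y : X) :
    ∃ E : Submodule ℝ X, Module.finrank ℝ E = 3 ∧ x ∈ E ∧ y ∈ E := by
  have hext : ∀ n ≤ 3, ∀ S : Submodule ℝ X, FiniteDimensional ℝ S → Module.finrank ℝ S + n = 3 →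
      ∃ E : Submodule ℝ X, Module.finrank ℝ E = 3 ∧ S ≤ E := by
    intro n
    induction n with
    | zero => exact fun _ S _ hS => ⟨S, hS, le_rfl⟩
    | succ n ih =>
      intro hn S hfin hS
      have hne : S ≠ ⊤ := by
        rintro rfl
        rw [← rank_top, ← Module.finrank_eq_rank] at hdim
        have : 3 ≤ Module.finrank ℝ (⊤ : Submodule ℝ X) := by exact_mod_cast hdim
        omega
      obtain ⟨v, -, hv⟩ := SetLike.exists_of_lt (lt_top_iff_ne_top.2 hne)
      have hv0 : v ≠ 0 := by rintro rfl; exact hv S.zero_mem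
      have h1 := Submodule.finrank_sup_add_finrank_inf_eq S (Submodule.span ℝ {v})
      have h2 : S ⊓ Submodule.span ℝ {v} = ⊥ :=
        ((Submodule.disjoint_span_singleton' hv0).2 hv).eq_bot
      rw [h2, finrank_bot, finrank_span_singleton hv0] at h1
      obtain ⟨E, hE, hSE⟩ := ih (by omega) (S ⊔ Submodule.span ℝ {v}) inferInstance (by omega)
      exact ⟨E, hE, le_sup_left.trans hSE⟩
  classical
  have hfin : FiniteDimensional ℝ (Submodule.span ℝ {x, y}) :=
    FiniteDimensional.span_of_finite ℝ (by simp)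
  have h1 := finrank_span_finset_le_card (R := ℝ) ({x, y} : Finset X)
  rw [Finset.coe_pair, Set.finrank] at h1
  have h2 : ({x, y} : Finset X).card ≤ 2 := Finset.card_le_two
  obtain ⟨E, hE, hSE⟩ := hext (3 - Module.finrank ℝ (Submodule.span ℝ {x, y})) (by omega)
    (Submodule.span ℝ {x, y}) hfin (by omega)
  exact ⟨E, hE, hSE (Submodule.subset_span (by simp)), hSE (Submodule.subset_span (by simp))⟩

end Transitive

end Helpers

theorem stmt_9 {X : Type*} [NormedAddCommGroup X] [NormedSpace ℝ X] [CompleteSpace X]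
    (hdim : 3 ≤ Module.rank ℝ X)
    (hAT : ∀ x y : X, ‖x‖ = 1 → ‖y‖ = 1 → ∀ ε > 0, ∃ T : X ≃L[ℝ] X,
      T x = y ∧ ‖(T : X →L[ℝ] X)‖ ≤ 1 + ε ∧ ‖(T.symm : X →L[ℝ] X)‖ ≤ 1 + ε)
    (hproj : ∀ ε > 0, ∃ (Z : Submodule ℝ X) (P : X →L[ℝ] X),
      Module.rank ℝ (X ⧸ Z) = 1 ∧ LinearMap.range (P : X →ₗ[ℝ] X) = Z ∧
      (∀ z ∈ Z, P z = z) ∧ ‖P‖ ≤ 1 + ε) :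
    ∀ x y : X, ‖x + y‖ ^ 2 + ‖x - y‖ ^ 2 = 2 * (‖x‖ ^ 2 + ‖y‖ ^ 2) := by
  intro x y
  obtain ⟨E, hE, hx, hy⟩ := exists_submodule_finrank_eq_three hdim x y
  have : FiniteDimensional ℝ E := Module.finite_of_finrank_eq_succ hE
  have hex := exists_contractsAlong_subspace E fun e he ε hε =>
    exists_almost_contractsAlong hAT hproj he hε
  exact parallelogram_of_support hE (mul_norm_le_of_exists_contractsAlong hE hex) hex
    ⟨x, hx⟩ ⟨y, hy⟩
end

section
/- For 1 < p < ∞ and any two 1-codimensional closed subspaces Z₁, Z₂ of L^p(0,1), the spaces Z₁ ⊕_p L^p and Z₂ ⊕_p L^p are isometrically isomorphic. -/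
open MeasureTheory
open scoped ENNReal

/-- The measure giving `L^p(0,1)`. -/
noncomputable def mu01 : Measure ℝ := volume.restrict (Set.Ioo (0 : ℝ) 1)

open ProbabilityTheory Set Filter Topology

instance : IsProbabilityMeasure mu01 := ⟨by simp [mu01]⟩

instance : NullSingletonClass mu01 := by unfold mu01; infer_instance

lemma mu01_Iic {t : ℝ} (h1 : t ≤ 1) : mu01 (Iic t) = ENNReal.ofReal t := by
  rw [mu01, restrict_Ioo_eq_restrict_Ioc, Measure.restrict_apply measurableSet_Iic]
  have : Iic t ∩ Ioc 0 1 = Ioc 0 t := by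
    ext x; simp only [mem_inter_iff, mem_Iic, mem_Ioc]; constructor
    · rintro ⟨h, h', -⟩; exact ⟨h', h⟩
    · rintro ⟨h, h'⟩; exact ⟨h', h, h'.trans h1⟩
  rw [this]; simp

lemma continuous_cdf (ν : Measure ℝ) [IsProbabilityMeasure ν] [NullSingletonClass ν] :
    Continuous (cdf ν) := by
  rw [continuous_iff_continuousAt]
  intro x
  rw [(monotone_cdf ν).continuousAt_iff_leftLim_eq_rightLim, (cdf ν).rightLim_eq]
  have h := (cdf ν).measure_singleton x
  rw [measure_cdf, measure_singleton] at h
  have h2 := (monotone_cdf ν).leftLim_le (le_refl x)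
  have := ENNReal.ofReal_eq_zero.1 h.symm
  linarith

lemma measure_cdf_le (ν : Measure ℝ) [IsProbabilityMeasure ν] [NullSingletonClass ν] {t : ℝ}
    (h0 : 0 < t) (h1 : t < 1) : ν {x | cdf ν x ≤ t} = ENNReal.ofReal t := by
  have hc := continuous_cdf ν
  have hm := monotone_cdf ν
  set S := {x | cdf ν x ≤ t} with hS
  have hne : S.Nonempty :=
    (((tendsto_cdf_atBot ν).eventually (gt_mem_nhds h0)).exists).imp fun x hx => le_of_lt hx
  obtain ⟨b, hb⟩ := ((tendsto_cdf_atTop ν).eventually (lt_mem_nhds h1)).exists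
  have hbd : BddAbove S := ⟨b, fun x hx => by
    by_contra hlt
    exact absurd (hm (not_le.1 hlt).le) (not_le.2 (lt_of_le_of_lt hx hb))⟩
  have hcl : IsClosed S := isClosed_le hc continuous_const
  have hmem : sSup S ∈ S := hcl.csSup_mem hne hbd
  have hSI : S = Iic (sSup S) := by
    ext x
    exact ⟨fun hx => le_csSup hbd hx, fun hx => (hm hx).trans hmem⟩
  have hval : cdf ν (sSup S) = t := by
    refine le_antisymm hmem ?_
    have : Tendsto (cdf ν) (𝓝[>] (sSup S)) (𝓝 (cdf ν (sSup S))) :=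
      hc.continuousAt.mono_left nhdsWithin_le_nhds
    refine ge_of_tendsto this ?_
    filter_upwards [self_mem_nhdsWithin] with y hy
    by_contra hlt
    exact absurd (le_csSup hbd (show y ∈ S from (not_le.1 hlt).le)) (not_le.2 hy)
  rw [hSI, ← ofReal_cdf, hval]

lemma map_cdf (ν : Measure ℝ) [IsProbabilityMeasure ν] [NullSingletonClass ν] :
    ν.map (cdf ν) = mu01 := by
  have hme : Measurable (cdf ν) := (monotone_cdf ν).measurable
  have : IsProbabilityMeasure (ν.map (cdf ν)) := Measure.isProbabilityMeasure_map hme.aemeasurable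
  refine Measure.ext_of_Iic _ _ fun t => ?_
  rw [Measure.map_apply hme measurableSet_Iic]
  change ν {x | cdf ν x ≤ t} = _
  rcases lt_or_ge t 1 with h1 | h1
  · rcases lt_or_ge 0 t with h0 | h0
    · rw [measure_cdf_le ν h0 h1, mu01_Iic h1.le]
    · have hz : ∀ μ : Measure ℝ, ∀ s : Set ℝ,
          (∀ ε : ℝ, 0 < ε → ε < 1 → μ s ≤ ENNReal.ofReal ε) → μ s = 0 := by
        intro μ s h
        have ht : Tendsto (fun ε : ℝ => ENNReal.ofReal ε) (𝓝[>] 0) (𝓝 0) := by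
          have := (ENNReal.continuous_ofReal.tendsto (0 : ℝ)).mono_left
            (nhdsWithin_le_nhds (s := Ioi (0 : ℝ)))
          simpa using this
        refine le_antisymm (ge_of_tendsto ht ?_) zero_le
        filter_upwards [Ioo_mem_nhdsGT (zero_lt_one (α := ℝ))] with ε hε using h ε hε.1 hε.2
      rw [hz ν {x | cdf ν x ≤ t} fun ε he he1 =>
          (measure_mono fun x (hx : cdf ν x ≤ t) => hx.trans (h0.trans he.le)).trans_eq
            (measure_cdf_le ν he he1),
        hz mu01 (Iic t) fun ε he he1 => (measure_mono (Iic_subset_Iic.2 (h0.trans he.le))).trans_eq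
          (mu01_Iic he1.le)]
  · have : {x | cdf ν x ≤ t} = univ := eq_univ_of_forall fun x => (cdf_le_one ν x).trans h1
    rw [this, measure_univ]
    refine le_antisymm ?_ prob_le_one
    calc (1 : ℝ≥0∞) = mu01 (Iic 1) := by rw [mu01_Iic le_rfl]; simp
      _ ≤ _ := measure_mono (Iic_subset_Iic.2 h1)

/-- An atomless probability measure on a standard Borel space is isomorphic modulo null sets to
Lebesgue measure on the unit interval. -/
lemma exists_map_eq_mu01 {X : Type*} [MeasurableSpace X] [StandardBorelSpace X]
    (ν : Measure X) [IsProbabilityMeasure ν] [NullSingletonClass ν] :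
    ∃ φ : X → ℝ, Measurable φ ∧ ν.map φ = mu01 ∧
      ∃ N, MeasurableSet N ∧ ν N = 0 ∧ InjOn φ Nᶜ := by
  have he := measurableEmbedding_embeddingReal X
  set e := embeddingReal X
  set ν' := ν.map e
  have : IsProbabilityMeasure ν' := Measure.isProbabilityMeasure_map he.measurable.aemeasurable
  have : NullSingletonClass ν' := ⟨fun x => by
    rw [he.map_apply]
    exact (subsingleton_singleton.preimage he.injective).measure_zero ν⟩
  have hme : Measurable (cdf ν') := (monotone_cdf ν').measurable
  have hmap : ν.map (cdf ν' ∘ e) = mu01 := by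
    rw [← Measure.map_map hme he.measurable, map_cdf]
  refine ⟨cdf ν' ∘ e, hme.comp he.measurable, hmap,
    ⋃ r : ℚ, (cdf ν' ∘ e) ⁻¹' {cdf ν' r}, .iUnion fun r =>
      (hme.comp he.measurable) (measurableSet_singleton _), ?_, ?_⟩
  · rw [measure_iUnion_null_iff]
    intro r
    rw [← Measure.map_apply (hme.comp he.measurable) (measurableSet_singleton _), hmap,
      measure_singleton]
  · have key : ∀ x y : X, y ∉ (⋃ r : ℚ, (cdf ν' ∘ e) ⁻¹' {cdf ν' r}) →
        cdf ν' (e x) = cdf ν' (e y) → ¬ e x < e y := by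
      intro x y hy hxy hlt
      obtain ⟨r, hr1, hr2⟩ := exists_rat_btwn hlt
      refine hy (mem_iUnion.2 ⟨r, ?_⟩)
      have h1 := monotone_cdf ν' hr1.le
      have h2 := monotone_cdf ν' hr2.le
      exact le_antisymm (hxy.symm.le.trans h1) h2
    intro x hx y hy hxy
    refine he.injective (le_antisymm ?_ ?_)
    · exact not_lt.1 (key y x hx hxy.symm)
    · exact not_lt.1 (key x y hy hxy)

section WeightedComposition

variable {X Y : Type*} [MeasurableSpace X] [MeasurableSpace Y] {M : Measure X} {N : Measure Y}
  {p : ℝ≥0∞} {φ : X → Y} {w : X → ℝ}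

lemma absolutelyContinuous_weight (hw : Measurable w) (hw0 : ∀ x, w x ≠ 0) :
    M ≪ M.withDensity (fun x => ‖w x‖ₑ ^ p.toReal) :=
  withDensity_absolutelyContinuous' (by fun_prop)
    (ae_of_all _ fun x => (ENNReal.rpow_pos (by simp [hw0 x]) (by simp)).ne')

lemma quasiMeasurePreserving_of_weight (hφ : Measurable φ) (hw : Measurable w)
    (hw0 : ∀ x, w x ≠ 0) (hmap : (M.withDensity (fun x => ‖w x‖ₑ ^ p.toReal)).map φ = N) :
    Measure.QuasiMeasurePreserving φ M N :=
  ⟨hφ, hmap ▸ (absolutelyContinuous_weight (p := p) hw hw0).map hφ⟩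

lemma eLpNorm_weightedComp (hp0 : p ≠ 0) (hptop : p ≠ ⊤) (hφ : Measurable φ) (hw : Measurable w)
    (hmap : (M.withDensity (fun x => ‖w x‖ₑ ^ p.toReal)).map φ = N)
    {h : Y → ℝ} (hh : AEStronglyMeasurable h N) :
    eLpNorm (fun x => w x * h (φ x)) p M = eLpNorm h p N := by
  rw [eLpNorm_eq_lintegral_rpow_enorm_toReal hp0 hptop,
    eLpNorm_eq_lintegral_rpow_enorm_toReal hp0 hptop]
  congr 1
  have hm : AEMeasurable (fun y => ‖h y‖ₑ ^ p.toReal) N := hh.enorm.pow_const _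
  subst hmap
  rw [lintegral_map' hm hφ.aemeasurable,
    lintegral_withDensity_eq_lintegral_mul_non_measurable _ (by fun_prop)
      (ae_of_all _ fun x => ENNReal.rpow_lt_top_of_nonneg (by simp) (by simp))]
  refine lintegral_congr fun x => ?_
  simp [enorm_mul, ENNReal.mul_rpow_of_nonneg]

/-- An almost everywhere injective change of variables, with the matching weight, induces an
isometric isomorphism of `L^p` spaces. -/
lemma exists_weightedComp_linearIsometryEquiv [StandardBorelSpace X] [StandardBorelSpace Y]
    [Fact (1 ≤ p)] (hptop : p ≠ ⊤) (hφ : Measurable φ) (hw : Measurable w) (hw0 : ∀ x, w x ≠ 0)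
    (hmap : (M.withDensity (fun x => ‖w x‖ₑ ^ p.toReal)).map φ = N)
    (hinj : ∃ N₀, MeasurableSet N₀ ∧ M N₀ = 0 ∧ InjOn φ N₀ᶜ) :
    ∃ T : Lp ℝ p N ≃ₗᵢ[ℝ] Lp ℝ p M, ∀ h, T h =ᵐ[M] fun x => w x * h (φ x) := by
  have hp0 : p ≠ 0 := (zero_lt_one.trans_le (Fact.out : 1 ≤ p)).ne'
  have hq := quasiMeasurePreserving_of_weight hφ hw hw0 hmap
  have hmeas : ∀ h : Y → ℝ, AEStronglyMeasurable h N →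
      AEStronglyMeasurable (fun x => w x * h (φ x)) M := fun h hh =>
    hw.aestronglyMeasurable.mul (hh.comp_quasiMeasurePreserving hq)
  have hmem : ∀ h : Y → ℝ, MemLp h p N → MemLp (fun x => w x * h (φ x)) p M := fun h hh =>
    ⟨hmeas h hh.1, by rw [eLpNorm_weightedComp hp0 hptop hφ hw hmap hh.1]; exact hh.2⟩
  let T₀ : Lp ℝ p N →ₗ[ℝ] Lp ℝ p M :=
    { toFun := fun h => (hmem h (Lp.memLp h)).toLp
      map_add' := fun a b => by
        rw [← MemLp.toLp_add, MemLp.toLp_eq_toLp_iff]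
        filter_upwards [hq.ae (Lp.coeFn_add a b)] with x hx
        simp only [Pi.add_apply] at hx ⊢
        rw [hx, mul_add]
      map_smul' := fun c a => by
        rw [RingHom.id_apply, ← MemLp.toLp_const_smul, MemLp.toLp_eq_toLp_iff]
        filter_upwards [hq.ae (Lp.coeFn_smul c a)] with x hx
        simp only [Pi.smul_apply, smul_eq_mul] at hx ⊢
        rw [hx, mul_left_comm] }
  have hT₀ : ∀ h, T₀ h =ᵐ[M] fun x => w x * h (φ x) := fun h =>
    MemLp.coeFn_toLp (hmem h (Lp.memLp h))
  let T₁ : Lp ℝ p N →ₗᵢ[ℝ] Lp ℝ p M := ⟨T₀, fun h => by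
    rw [Lp.norm_def, Lp.norm_def, eLpNorm_congr_ae (hT₀ h),
      eLpNorm_weightedComp hp0 hptop hφ hw hmap (Lp.aestronglyMeasurable h)]⟩
  have hsurj : Function.Surjective T₁ := by
    intro k
    obtain ⟨N₀, hN, hN0, hinj⟩ := hinj
    have hk := Lp.stronglyMeasurable k
    have hemb : MeasurableEmbedding (fun x : (N₀ᶜ : Set X) => φ x) := by
      have := hN.compl.standardBorel
      exact (hφ.comp measurable_subtype_coe).measurableEmbedding
        fun x y hxy => Subtype.ext (hinj x.2 y.2 hxy)
    obtain ⟨h, hh, hhk⟩ := hemb.exists_measurable_extend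
      (g := fun x : (N₀ᶜ : Set X) => k x / w x)
      ((hk.measurable.div hw).comp measurable_subtype_coe) (fun _ => ⟨0⟩)
    have hae : (fun x => w x * h (φ x)) =ᵐ[M] k := by
      filter_upwards [compl_mem_ae_iff.2 hN0] with x hx
      have : h (φ x) = k x / w x := congrFun hhk ⟨x, hx⟩
      rw [this, mul_div_cancel₀ _ (hw0 x)]
    have hhm : MemLp h p N := ⟨hh.aestronglyMeasurable, by
      rw [← eLpNorm_weightedComp hp0 hptop hφ hw hmap hh.aestronglyMeasurable,
        eLpNorm_congr_ae hae]
      exact Lp.eLpNorm_lt_top k⟩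
    refine ⟨hhm.toLp, Lp.ext ((hT₀ _).trans (EventuallyEq.trans ?_ hae))⟩
    filter_upwards [hq.ae hhm.coeFn_toLp] with x hx
    rw [hx]
  exact ⟨LinearIsometryEquiv.ofSurjective T₁ hsurj, fun h => hT₀ h⟩

end WeightedComposition

section TwoCopies

variable {α : Type*} [MeasurableSpace α]

/-- The disjoint union of two copies of a measure space. -/
noncomputable def twoCopies (μ : Measure α) : Measure (α × Bool) :=
  μ.map (fun x => (x, true)) + μ.map (fun x => (x, false))

variable {μ : Measure α} {p : ℝ≥0∞}

lemma measurableEmbedding_prodMk_bool (b : Bool) :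
    MeasurableEmbedding (fun x : α => (x, b)) :=
  measurableEmbedding_prod_mk_right b

lemma twoCopies_apply {s : Set (α × Bool)} (hs : MeasurableSet s) :
    twoCopies μ s = μ {x | (x, true) ∈ s} + μ {x | (x, false) ∈ s} := by
  rw [twoCopies, Measure.add_apply, Measure.map_apply (by fun_prop) hs,
    Measure.map_apply (by fun_prop) hs]
  rfl

instance [IsFiniteMeasure μ] : IsFiniteMeasure (twoCopies μ) := by
  unfold twoCopies; infer_instance

instance [MeasurableSingletonClass α] [NullSingletonClass μ] :
    NullSingletonClass (twoCopies μ) := ⟨fun x => by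
  rw [twoCopies_apply (measurableSet_singleton x)]
  have (b : Bool) : μ {y | (y, b) ∈ ({x} : Set (α × Bool))} = 0 :=
    (subsingleton_singleton.preimage (measurableEmbedding_prodMk_bool b).injective).measure_zero μ
  simp only [this, add_zero]⟩

lemma lintegral_twoCopies {f : α × Bool → ℝ≥0∞} :
    ∫⁻ x, f x ∂twoCopies μ = ∫⁻ x, f (x, true) ∂μ + ∫⁻ x, f (x, false) ∂μ := by
  rw [twoCopies, lintegral_add_measure, (measurableEmbedding_prodMk_bool true).lintegral_map,
    (measurableEmbedding_prodMk_bool false).lintegral_map]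

lemma quasiMeasurePreserving_twoCopies (b : Bool) :
    Measure.QuasiMeasurePreserving (fun x : α => (x, b)) μ (twoCopies μ) := by
  refine ⟨by fun_prop, ?_⟩
  cases b
  · exact Measure.absolutelyContinuous_of_le (Measure.le_add_left le_rfl)
  · exact Measure.absolutelyContinuous_of_le (Measure.le_add_right le_rfl)

lemma setIntegral_twoCopies (f : α × Bool → ℝ) :
    ∫ x in {x | x.2 = true}, f x ∂twoCopies μ = ∫ x, f (x, true) ∂μ := by
  rw [← (measurableEmbedding_prodMk_bool true).integral_map f]
  congr 1
  have hS : MeasurableSet {x : α × Bool | x.2 = true} :=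
    measurable_snd (measurableSet_singleton true)
  ext s hs
  rw [Measure.restrict_apply hs, twoCopies_apply (hs.inter hS), Measure.map_apply (by fun_prop) hs]
  simp [preimage]

lemma eLpNorm_twoCopies (hp0 : p ≠ 0) (hptop : p ≠ ⊤) (f : α × Bool → ℝ) :
    eLpNorm f p (twoCopies μ) ^ p.toReal =
      eLpNorm (fun x => f (x, true)) p μ ^ p.toReal +
        eLpNorm (fun x => f (x, false)) p μ ^ p.toReal := by
  have hr : p.toReal ≠ 0 := (ENNReal.toReal_pos hp0 hptop).ne'
  simp only [eLpNorm_eq_lintegral_rpow_enorm_toReal hp0 hptop, one_div,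
    ENNReal.rpow_inv_rpow hr, lintegral_twoCopies]

variable (μ) in
/-- `L^p` of two copies of a measure space is the `ℓ^p`-sum of two copies of `L^p`. -/
lemma exists_twoCopies_linearIsometryEquiv [Fact (1 ≤ p)] (hptop : p ≠ ⊤) :
    ∃ J : Lp ℝ p (twoCopies μ) ≃ₗᵢ[ℝ] WithLp p (Lp ℝ p μ × Lp ℝ p μ),
      ∀ h, (J h).fst =ᵐ[μ] fun x => h (x, true) := by
  have hp0 : p ≠ 0 := (zero_lt_one.trans_le (Fact.out : 1 ≤ p)).ne'
  have hr : 0 < p.toReal := ENNReal.toReal_pos hp0 hptop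
  have hmem : ∀ (b : Bool) (h : α × Bool → ℝ), MemLp h p (twoCopies μ) →
      MemLp (fun x => h (x, b)) p μ := fun b h hh => by
    refine ⟨hh.1.comp_quasiMeasurePreserving (quasiMeasurePreserving_twoCopies b), ?_⟩
    have h1 := ENNReal.rpow_lt_top_of_nonneg hr.le hh.2.ne
    rw [eLpNorm_twoCopies hp0 hptop, ENNReal.add_lt_top] at h1
    rw [← ENNReal.rpow_lt_top_iff_of_pos hr]
    cases b
    exacts [h1.2, h1.1]
  let R : Bool → Lp ℝ p (twoCopies μ) →ₗ[ℝ] Lp ℝ p μ := fun b =>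
    { toFun := fun h => (hmem b h (Lp.memLp h)).toLp
      map_add' := fun u v => by
        rw [← MemLp.toLp_add, MemLp.toLp_eq_toLp_iff]
        exact (quasiMeasurePreserving_twoCopies b).ae (Lp.coeFn_add u v)
      map_smul' := fun c u => by
        rw [RingHom.id_apply, ← MemLp.toLp_const_smul, MemLp.toLp_eq_toLp_iff]
        exact (quasiMeasurePreserving_twoCopies b).ae (Lp.coeFn_smul c u) }
  have hR : ∀ b h, R b h =ᵐ[μ] fun x => h (x, b) := fun b h =>
    MemLp.coeFn_toLp (hmem b h (Lp.memLp h))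
  let J₀ : Lp ℝ p (twoCopies μ) →ₗ[ℝ] WithLp p (Lp ℝ p μ × Lp ℝ p μ) :=
    (WithLp.linearEquiv p ℝ (Lp ℝ p μ × Lp ℝ p μ)).symm.toLinearMap ∘ₗ (R true).prod (R false)
  let J₁ : Lp ℝ p (twoCopies μ) →ₗᵢ[ℝ] WithLp p (Lp ℝ p μ × Lp ℝ p μ) := ⟨J₀, fun h => by
    have h1 : (J₀ h).fst = R true h := rfl
    have h2 : (J₀ h).snd = R false h := rfl
    rw [WithLp.prod_norm_eq_add hr, h1, h2, Lp.norm_def, Lp.norm_def, Lp.norm_def,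
      eLpNorm_congr_ae (hR true h), eLpNorm_congr_ae (hR false h), ENNReal.toReal_rpow,
      ENNReal.toReal_rpow, ← ENNReal.toReal_add, ← eLpNorm_twoCopies hp0 hptop,
      ENNReal.toReal_rpow, one_div, ENNReal.rpow_rpow_inv hr.ne']
    · exact (ENNReal.rpow_lt_top_of_nonneg hr.le (hmem true h (Lp.memLp h)).2.ne).ne
    · exact (ENNReal.rpow_lt_top_of_nonneg hr.le (hmem false h (Lp.memLp h)).2.ne).ne⟩
  have hsurj : Function.Surjective J₁ := by
    intro u
    let k : α × Bool → ℝ := fun x => if x.2 = true then u.fst x.1 else u.snd x.1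
    have hk : Measurable k := Measurable.ite (measurable_snd (measurableSet_singleton true))
      ((Lp.stronglyMeasurable u.fst).measurable.comp measurable_fst)
      ((Lp.stronglyMeasurable u.snd).measurable.comp measurable_fst)
    have hkm : MemLp k p (twoCopies μ) := by
      refine ⟨hk.aestronglyMeasurable, ?_⟩
      rw [← ENNReal.rpow_lt_top_iff_of_pos hr, eLpNorm_twoCopies hp0 hptop, ENNReal.add_lt_top]
      constructor
      · simpa [k] using ENNReal.rpow_lt_top_of_nonneg hr.le (Lp.eLpNorm_ne_top u.fst)
      · simpa [k] using ENNReal.rpow_lt_top_of_nonneg hr.le (Lp.eLpNorm_ne_top u.snd)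
    have h1 : R true hkm.toLp = u.fst := Lp.ext <| (hR true _).trans <| by
      filter_upwards [(quasiMeasurePreserving_twoCopies true).ae hkm.coeFn_toLp] with x hx
      rw [hx]; simp [k]
    have h2 : R false hkm.toLp = u.snd := Lp.ext <| (hR false _).trans <| by
      filter_upwards [(quasiMeasurePreserving_twoCopies false).ae hkm.coeFn_toLp] with x hx
      rw [hx]; simp [k]
    refine ⟨hkm.toLp, ?_⟩
    change WithLp.toLp p (R true hkm.toLp, R false hkm.toLp) = u
    rw [h1, h2]
    rfl
  exact ⟨LinearIsometryEquiv.ofSurjective J₁ hsurj, fun h => hR true h⟩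

end TwoCopies

/-- An atomless measure split into two parts of mass one is isomorphic modulo null sets to two
copies of the unit interval, in a way that respects the splitting. -/
lemma exists_map_eq_twoCopies {X : Type*} [MeasurableSpace X] [StandardBorelSpace X]
    (D : Measure X) [NullSingletonClass D] {A : Set X} (hA : MeasurableSet A) (h1 : D A = 1)
    (h2 : D Aᶜ = 1) :
    ∃ φ : X → ℝ × Bool, Measurable φ ∧ D.map φ = twoCopies mu01 ∧
      (∃ N, MeasurableSet N ∧ D N = 0 ∧ InjOn φ Nᶜ) ∧ ∀ x, (φ x).2 = true ↔ x ∈ A := by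
  classical
  have : IsProbabilityMeasure (D.restrict A) := ⟨by simp [h1]⟩
  have : IsProbabilityMeasure (D.restrict Aᶜ) := ⟨by simp [h2]⟩
  obtain ⟨φ₁, hφ₁, hm₁, N₁, hN₁, hz₁, hi₁⟩ := exists_map_eq_mu01 (D.restrict A)
  obtain ⟨φ₂, hφ₂, hm₂, N₂, hN₂, hz₂, hi₂⟩ := exists_map_eq_mu01 (D.restrict Aᶜ)
  let φ : X → ℝ × Bool := A.piecewise (fun x => (φ₁ x, true)) (fun x => (φ₂ x, false))
  have hφ : Measurable φ := Measurable.piecewise hA (by fun_prop) (by fun_prop)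
  have hφA : ∀ x ∈ A, φ x = (φ₁ x, true) := fun x hx => piecewise_eq_of_mem _ _ _ hx
  have hφA' : ∀ x ∈ Aᶜ, φ x = (φ₂ x, false) := fun x hx => piecewise_eq_of_notMem _ _ _ hx
  refine ⟨φ, hφ, ?_, ⟨(N₁ ∩ A) ∪ (N₂ ∩ Aᶜ), (hN₁.inter hA).union (hN₂.inter hA.compl), ?_, ?_⟩,
    fun x => ?_⟩
  · rw [← Measure.restrict_add_restrict_compl (μ := D) hA, Measure.map_add _ _ hφ, twoCopies]
    congr 1
    · rw [Measure.map_congr (ae_restrict_of_forall_mem hA hφA), ← hm₁,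
        Measure.map_map (by fun_prop) hφ₁]
      rfl
    · rw [Measure.map_congr (ae_restrict_of_forall_mem hA.compl hφA'), ← hm₂,
        Measure.map_map (by fun_prop) hφ₂]
      rfl
  · rw [Measure.restrict_apply hN₁] at hz₁
    rw [Measure.restrict_apply hN₂] at hz₂
    exact measure_union_null hz₁ hz₂
  · intro x hx y hy hxy
    simp only [mem_compl_iff, mem_union, mem_inter_iff, not_or, not_and, not_not] at hx hy
    by_cases hxA : x ∈ A <;> by_cases hyA : y ∈ A
    · rw [hφA x hxA, hφA y hyA, Prod.mk.injEq] at hxy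
      exact hi₁ (fun h => hx.1 h hxA) (fun h => hy.1 h hyA) hxy.1
    · rw [hφA x hxA, hφA' y hyA] at hxy; simp at hxy
    · rw [hφA' x hxA, hφA y hyA] at hxy; simp at hxy
    · rw [hφA' x hxA, hφA' y hyA, Prod.mk.injEq] at hxy
      exact hi₂ (fun h => hxA (hx.2 h)) (fun h => hyA (hy.2 h)) hxy.1
  · by_cases hx : x ∈ A
    · simp [hφA x hx, hx]
    · simp [hφA' x hx, hx]

/-- A linear isometry of an `ℓ^p`-sum that matches two subspaces of the first summand restricts to
the corresponding `ℓ^p`-sums of subspaces. -/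
lemma nonempty_linearIsometryEquiv_of_fst_mem_iff {E F : Type*} [NormedAddCommGroup E]
    [NormedSpace ℝ E] [NormedAddCommGroup F] [NormedSpace ℝ F] {p : ℝ≥0∞} [Fact (1 ≤ p)]
    (hptop : p ≠ ⊤) {Z₁ Z₂ : Submodule ℝ E} (S : WithLp p (E × F) ≃ₗᵢ[ℝ] WithLp p (E × F))
    (hS : ∀ u, (S u).fst ∈ Z₂ ↔ u.fst ∈ Z₁) :
    Nonempty (WithLp p (Z₁ × F) ≃ₗᵢ[ℝ] WithLp p (Z₂ × F)) := by
  have hr : 0 < p.toReal :=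
    ENNReal.toReal_pos (zero_lt_one.trans_le (Fact.out : 1 ≤ p)).ne' hptop
  let ι : ∀ Z : Submodule ℝ E, WithLp p (Z × F) → WithLp p (E × F) := fun Z u =>
    WithLp.toLp p ((u.fst : E), u.snd)
  have hmem : ∀ u : WithLp p (Z₁ × F), (S (ι Z₁ u)).fst ∈ Z₂ := fun u => (hS _).2 u.fst.2
  have hmem' : ∀ u : WithLp p (Z₂ × F), (S.symm (ι Z₂ u)).fst ∈ Z₁ := fun u => by
    rw [← hS, S.apply_symm_apply]; exact u.fst.2
  let f : WithLp p (Z₁ × F) →ₗ[ℝ] WithLp p (Z₂ × F) :=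
    { toFun := fun u => WithLp.toLp p (⟨(S (ι Z₁ u)).fst, hmem u⟩, (S (ι Z₁ u)).snd)
      map_add' := fun u v => by
        have h : ι Z₁ (u + v) = ι Z₁ u + ι Z₁ v := rfl
        simp only [h, map_add]
        rfl
      map_smul' := fun c u => by
        have h : ι Z₁ (c • u) = c • ι Z₁ u := rfl
        simp only [h, map_smul]
        rfl }
  let T : WithLp p (Z₁ × F) →ₗᵢ[ℝ] WithLp p (Z₂ × F) := ⟨f, fun u => by
    have h1 : ‖f u‖ = ‖S (ι Z₁ u)‖ := by
      rw [WithLp.prod_norm_eq_add hr, WithLp.prod_norm_eq_add hr]; rfl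
    have h2 : ‖ι Z₁ u‖ = ‖u‖ := by
      rw [WithLp.prod_norm_eq_add hr, WithLp.prod_norm_eq_add hr]; rfl
    rw [h1, S.norm_map, h2]⟩
  refine ⟨LinearIsometryEquiv.ofSurjective T fun v => ?_⟩
  refine ⟨WithLp.toLp p (⟨(S.symm (ι Z₂ v)).fst, hmem' v⟩, (S.symm (ι Z₂ v)).snd), ?_⟩
  set u : WithLp p (Z₁ × F) :=
    WithLp.toLp p (⟨(S.symm (ι Z₂ v)).fst, hmem' v⟩, (S.symm (ι Z₂ v)).snd)
  have h : S (ι Z₁ u) = ι Z₂ v := S.apply_symm_apply (ι Z₂ v)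
  change WithLp.toLp p ((⟨(S (ι Z₁ u)).fst, hmem u⟩ : Z₂), (S (ι Z₁ u)).snd) = v
  simp only [h]
  rfl

section Dual

variable {α : Type*} [MeasurableSpace α] {μ : Measure α} [IsFiniteMeasure μ] {p q : ℝ≥0∞}

lemma hasSum_indicatorConstLp [Fact (1 ≤ p)] (hptop : p ≠ ⊤) {E : ℕ → Set α}
    (hE : ∀ i, MeasurableSet (E i)) (hd : Pairwise (Function.onFun Disjoint E)) :
    HasSum (fun i => indicatorConstLp p (hE i) (measure_ne_top μ _) (1 : ℝ))
      (indicatorConstLp p (MeasurableSet.iUnion hE) (measure_ne_top μ _) (1 : ℝ)) := by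
  have hU : ∀ s : Finset ℕ, MeasurableSet (⋃ i ∈ s, E i) := fun s =>
    s.measurableSet_biUnion fun i _ => hE i
  have hsum : ∀ s : Finset ℕ,
      ∑ i ∈ s, indicatorConstLp p (hE i) (measure_ne_top μ _) (1 : ℝ) =
        indicatorConstLp p (hU s) (measure_ne_top μ _) (1 : ℝ) := by
    intro s
    induction s using Finset.induction_on with
    | empty => simp
    | insert a s ha ih =>
      rw [Finset.sum_insert ha, ih, ← indicatorConstLp_disjoint_union]
      · congr 1
        simp
      · exact disjoint_iUnion₂_right.2 fun i hi => hd (ne_of_mem_of_not_mem hi ha).symm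
  unfold HasSum
  simp only [SummationFilter.unconditional_filter, hsum]
  refine tendsto_indicatorConstLp_set hptop ?_
  have hfin : ∑' i, μ (E i) ≠ ⊤ := by
    rw [← measure_iUnion hd hE]; exact measure_ne_top μ _
  refine tendsto_of_tendsto_of_tendsto_of_le_of_le tendsto_const_nhds
    (ENNReal.tendsto_tsum_compl_atTop_zero hfin) (fun _ => zero_le) fun s => ?_
  calc μ (symmDiff (⋃ i ∈ s, E i) (⋃ i, E i))
      ≤ μ (⋃ i : {i // i ∉ s}, E i) := by
        refine measure_mono fun x hx => ?_
        rcases hx with ⟨h1, h2⟩ | ⟨h1, h2⟩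
        · exact absurd (iUnion₂_subset_iUnion _ _ h1) h2
        · obtain ⟨i, hi⟩ := mem_iUnion.1 h1
          exact mem_iUnion.2 ⟨⟨i, fun his => h2 (mem_iUnion₂.2 ⟨i, his, hi⟩)⟩, hi⟩
    _ ≤ _ := measure_iUnion_le _

/-- A continuous functional on `L^p` is given on indicators by an integrable density. -/
lemma exists_integrable_density [Fact (1 ≤ p)] (hptop : p ≠ ⊤) (f : Lp ℝ p μ →L[ℝ] ℝ) :
    ∃ g : α → ℝ, Measurable g ∧ Integrable g μ ∧ ∀ E, (hE : MeasurableSet E) →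
      f (indicatorConstLp p hE (measure_ne_top μ _) (1 : ℝ)) = ∫ x in E, g x ∂μ := by
  classical
  let s : SignedMeasure α :=
    { measureOf' := fun E => if hE : MeasurableSet E then
        f (indicatorConstLp p hE (measure_ne_top μ _) (1 : ℝ)) else 0
      empty' := by simp
      not_measurable' := fun E hE => dif_neg hE
      m_iUnion' := fun E hE hd => by
        simp only [hE, MeasurableSet.iUnion hE, dif_pos]
        exact f.hasSum (hasSum_indicatorConstLp hptop hE hd) }
  have hs : ∀ E, (hE : MeasurableSet E) →
      s E = f (indicatorConstLp p hE (measure_ne_top μ _) (1 : ℝ)) := fun E hE => dif_pos hE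
  have hac : VectorMeasure.AbsolutelyContinuous s μ.toENNRealVectorMeasure := by
    refine VectorMeasure.AbsolutelyContinuous.mk fun E hE h0 => ?_
    rw [Measure.toENNRealVectorMeasure_apply_measurable hE] at h0
    have : indicatorConstLp p hE (measure_ne_top μ _) (1 : ℝ) = 0 := by
      rw [Lp.eq_zero_iff_ae_eq_zero]
      filter_upwards [indicatorConstLp_coeFn (p := p) (hs := hE) (hμs := measure_ne_top μ _)
        (c := (1 : ℝ)), compl_mem_ae_iff.2 h0] with x hx hxE
      rw [hx]; exact indicator_of_notMem hxE _
    rw [hs E hE, this, map_zero]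
  refine ⟨s.rnDeriv μ, SignedMeasure.measurable_rnDeriv s μ, SignedMeasure.integrable_rnDeriv s μ,
    fun E hE => ?_⟩
  rw [← hs E hE, ← withDensityᵥ_apply (SignedMeasure.integrable_rnDeriv s μ) hE,
    SignedMeasure.withDensityᵥ_rnDeriv_eq s μ hac]

variable [Fact (1 ≤ p)] [Fact (1 ≤ q)] [ENNReal.HolderConjugate q p]

lemma apply_eq_integral_of_indicator (hptop : p ≠ ⊤) (f : Lp ℝ p μ →L[ℝ] ℝ) {g : α → ℝ}
    (hg : MemLp g q μ) (hind : ∀ E, (hE : MeasurableSet E) →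
      f (indicatorConstLp p hE (measure_ne_top μ _) (1 : ℝ)) = ∫ x in E, g x ∂μ)
    (h : Lp ℝ p μ) : f h = ∫ x, g x * h x ∂μ := by
  set f' : Lp ℝ p μ →L[ℝ] ℝ := (ContinuousLinearMap.mul ℝ ℝ).lpPairing μ q p hg.toLp
  have hf' : ∀ u : Lp ℝ p μ, f' u = ∫ x, g x * u x ∂μ := fun u => by
    rw [ContinuousLinearMap.lpPairing_eq_integral]
    refine integral_congr_ae ?_
    filter_upwards [hg.coeFn_toLp] with x hx
    simp [hx]
  rw [← hf']
  induction h using Lp.induction hptop with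
  | indicatorConst c hs hμs =>
    have hc : indicatorConstLp p hs hμs.ne c = c • indicatorConstLp p hs hμs.ne (1 : ℝ) := by
      refine Lp.ext ?_
      filter_upwards [indicatorConstLp_coeFn (p := p) (hs := hs) (hμs := hμs.ne) (c := c),
        Lp.coeFn_smul c (indicatorConstLp p hs hμs.ne (1 : ℝ)),
        indicatorConstLp_coeFn (p := p) (hs := hs) (hμs := hμs.ne) (c := (1 : ℝ))] with x h1 h2 h3
      rw [h1, h2, Pi.smul_apply, h3]
      simp [indicator]
    rw [Lp.simpleFunc.coe_indicatorConst, hc, map_smul, map_smul, hind _ hs, hf',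
      ← integral_indicator hs]
    congr 1
    refine integral_congr_ae ?_
    filter_upwards [indicatorConstLp_coeFn (p := p) (hs := hs) (hμs := hμs.ne) (c := (1 : ℝ))]
      with x h1
    rw [h1]
    simp [indicator]
  | add hu hv _ h1 h2 => rw [map_add, map_add, h1, h2]
  | isClosed => exact isClosed_eq f.continuous f'.continuous

lemma abs_mul_rpow_abs_sub_two {r : ℝ} (hr : 1 < r) (x : ℝ) :
    |x * |x| ^ (r - 2)| = |x| ^ (r - 1) := by
  rcases eq_or_ne x 0 with rfl | hx
  · simp [Real.zero_rpow (sub_ne_zero.2 hr.ne')]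
  · have hx' : 0 < |x| := abs_pos.2 hx
    rw [abs_mul, abs_of_nonneg (Real.rpow_nonneg hx'.le _), mul_comm, ← Real.rpow_add_one hx'.ne']
    congr 1; ring

lemma mul_mul_rpow_abs_sub_two {r : ℝ} (hr : 1 < r) (x : ℝ) :
    x * (x * |x| ^ (r - 2)) = |x| ^ r := by
  rcases eq_or_ne x 0 with rfl | hx
  · simp [Real.zero_rpow (zero_lt_one.trans hr).ne']
  · have hx' : 0 < |x| := abs_pos.2 hx
    rw [← mul_assoc, ← abs_mul_abs_self x, mul_assoc, mul_comm (|x|) (|x| ^ (r - 2)),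
      ← Real.rpow_add_one hx'.ne', mul_comm, ← Real.rpow_add_one hx'.ne']
    congr 1; ring

lemma lintegral_bounded_density_le (hptop : p ≠ ⊤) (hpq : p.toReal.HolderConjugate q.toReal)
    (f : Lp ℝ p μ →L[ℝ] ℝ) {g : α → ℝ} (hg : Measurable g)
    (hind : ∀ E, (hE : MeasurableSet E) →
      f (indicatorConstLp p hE (measure_ne_top μ _) (1 : ℝ)) = ∫ x in E, g x ∂μ) (n : ℕ) :
    ∫⁻ x in {x | |g x| ≤ n}, ‖g x‖ₑ ^ q.toReal ∂μ ≤ ENNReal.ofReal (‖f‖ ^ q.toReal) := by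
  have hq0 : q ≠ 0 := (zero_lt_one.trans_le (Fact.out : 1 ≤ q)).ne'
  have hp0 : p ≠ 0 := (zero_lt_one.trans_le (Fact.out : 1 ≤ p)).ne'
  have hqr := hpq.symm.lt
  set E : Set α := {x | |g x| ≤ n} with hEdef
  have hE : MeasurableSet E := measurableSet_le (by fun_prop) measurable_const
  set G : α → ℝ := E.indicator g with hG
  have hGm : Measurable G := hg.indicator hE
  have hGb : ∀ x, |G x| ≤ n := fun x => by
    by_cases hx : x ∈ E
    · rw [hG, indicator_of_mem hx]; exact hx
    · rw [hG, indicator_of_notMem hx]; simp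
  have hGq : MemLp G q μ := MemLp.of_bound hGm.aestronglyMeasurable n (ae_of_all _ hGb)
  have h1 : MemLp (E.indicator fun _ => (1 : ℝ)) ⊤ μ :=
    memLp_indicator_const _ hE _ (Or.inr (measure_ne_top μ _))
  set m : Lp ℝ p μ →L[ℝ] Lp ℝ p μ := (ContinuousLinearMap.mul ℝ ℝ).holderL μ ⊤ p p h1.toLp
  have hm : ∀ u : Lp ℝ p μ, m u =ᵐ[μ] E.indicator u := fun u => by
    refine ((ContinuousLinearMap.mul ℝ ℝ).coeFn_holder _ u).trans ?_
    filter_upwards [h1.coeFn_toLp] with x hx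
    simp [hx, indicator]
  have hind' : ∀ F, (hF : MeasurableSet F) →
      (f ∘L m) (indicatorConstLp p hF (measure_ne_top μ _) (1 : ℝ)) = ∫ x in F, G x ∂μ := by
    intro F hF
    have : m (indicatorConstLp p hF (measure_ne_top μ _) (1 : ℝ)) =
        indicatorConstLp p (hF.inter hE) (measure_ne_top μ _) (1 : ℝ) := by
      refine Lp.ext ((hm _).trans ?_)
      filter_upwards [indicatorConstLp_coeFn (p := p) (hs := hF) (hμs := measure_ne_top μ _)
        (c := (1 : ℝ)), indicatorConstLp_coeFn (p := p) (hs := hF.inter hE)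
        (hμs := measure_ne_top μ _) (c := (1 : ℝ))] with x h2 h3
      rw [h3, inter_comm, ← indicator_indicator]
      simp only [indicator] at h2 ⊢
      rw [h2]
    rw [ContinuousLinearMap.comp_apply, this, hind _ (hF.inter hE), hG,
      setIntegral_indicator hE]
  set h : α → ℝ := fun x => G x * |G x| ^ (q.toReal - 2) with hh
  have hhn : ∀ x, |h x| = |G x| ^ (q.toReal - 1) := fun x =>
    abs_mul_rpow_abs_sub_two hqr (G x)
  have hhp : MemLp h p μ := by
    refine MemLp.of_bound (by fun_prop) ((n : ℝ) ^ (q.toReal - 1)) (ae_of_all _ fun x => ?_)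
    rw [Real.norm_eq_abs, hhn]
    exact Real.rpow_le_rpow (abs_nonneg _) (hGb x) (by linarith)
  set K : ℝ≥0∞ := ∫⁻ x, ‖G x‖ₑ ^ q.toReal ∂μ with hK
  have hKE : ∫⁻ x in E, ‖g x‖ₑ ^ q.toReal ∂μ = K := by
    rw [hK, ← lintegral_indicator hE]
    refine lintegral_congr fun x => ?_
    by_cases hx : x ∈ E
    · simp [hG, hx]
    · simp [hG, hx, hpq.symm.pos]
  have hnorm : ‖hhp.toLp‖ = K.toReal ^ (1 / p.toReal) := by
    rw [Lp.norm_toLp, eLpNorm_eq_lintegral_rpow_enorm_toReal hp0 hptop, ENNReal.toReal_rpow]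
    congr 2
    refine lintegral_congr fun x => ?_
    rw [← Real.enorm_abs, hhn, ← Real.enorm_abs (G x),
      Real.enorm_rpow_of_nonneg (abs_nonneg _) (by linarith), ← ENNReal.rpow_mul]
    congr 1
    exact hpq.symm.sub_one_mul_conj
  have hKfin : K ≠ ⊤ := by
    have : q ≠ ⊤ := by rintro rfl; simp at hqr; linarith
    exact (lintegral_rpow_enorm_lt_top_of_eLpNorm_lt_top hq0 this hGq.2).ne
  have hval : f hhp.toLp = K.toReal := by
    have hmh : m hhp.toLp = hhp.toLp := by
      refine Lp.ext ((hm _).trans ?_)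
      filter_upwards [hhp.coeFn_toLp] with x hx
      by_cases hxE : x ∈ E
      · rw [indicator_of_mem hxE]
      · rw [indicator_of_notMem hxE, hx, hh]
        simp [hG, hxE]
    have := apply_eq_integral_of_indicator hptop (f ∘L m) hGq hind' hhp.toLp
    rw [ContinuousLinearMap.comp_apply, hmh] at this
    rw [this, hK, ← integral_toReal (by fun_prop)
      (ae_of_all _ fun x => ENNReal.rpow_lt_top_of_nonneg hpq.symm.nonneg (by simp))]
    refine integral_congr_ae ?_
    filter_upwards [hhp.coeFn_toLp] with x hx
    rw [hx, hh, mul_mul_rpow_abs_sub_two hqr, ← ENNReal.toReal_rpow]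
    simp
  have hle : K.toReal ≤ ‖f‖ * K.toReal ^ (1 / p.toReal) := by
    rw [← hnorm, ← hval]
    exact (le_abs_self _).trans (f.le_opNorm _)
  rw [hKE, ENNReal.le_ofReal_iff_toReal_le hKfin (by positivity)]
  rcases eq_or_lt_of_le (ENNReal.toReal_nonneg (a := K)) with h0 | h0
  · rw [← h0]; positivity
  · have h2 : K.toReal ^ (1 / q.toReal) ≤ ‖f‖ := by
      have h3 : 0 < K.toReal ^ (1 / p.toReal) := Real.rpow_pos_of_pos h0 _
      rw [← mul_le_mul_iff_of_pos_right h3, ← Real.rpow_add h0]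
      have h4 : 1 / q.toReal + 1 / p.toReal = 1 := by
        rw [one_div, one_div, add_comm]; exact hpq.inv_add_inv_eq_one
      rw [h4, Real.rpow_one]
      exact hle
    calc K.toReal = (K.toReal ^ (1 / q.toReal)) ^ q.toReal := by
          rw [one_div, Real.rpow_inv_rpow h0.le hpq.symm.ne_zero]
      _ ≤ _ := Real.rpow_le_rpow (by positivity) h2 hpq.symm.nonneg

/-- Every continuous functional on `L^p` of a finite measure is given by a function in the
conjugate space `L^q`. -/
lemma exists_memLp_density (hptop : p ≠ ⊤) (hpq : p.toReal.HolderConjugate q.toReal)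
    (f : Lp ℝ p μ →L[ℝ] ℝ) :
    ∃ g : α → ℝ, Measurable g ∧ MemLp g q μ ∧ ∀ h : Lp ℝ p μ, f h = ∫ x, g x * h x ∂μ := by
  obtain ⟨g, hg, -, hind⟩ := exists_integrable_density hptop f
  have hq0 : q ≠ 0 := (zero_lt_one.trans_le (Fact.out : 1 ≤ q)).ne'
  have hqtop : q ≠ ⊤ := by
    rintro rfl
    have := hpq.symm.lt
    simp at this
    linarith
  have hgq : MemLp g q μ := by
    refine ⟨hg.aestronglyMeasurable, ?_⟩
    rw [eLpNorm_lt_top_iff_lintegral_rpow_enorm_lt_top hq0 hqtop]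
    have hU : (⋃ n : ℕ, {x | |g x| ≤ n}) = univ := eq_univ_of_forall fun x =>
      mem_iUnion.2 (exists_nat_ge |g x|)
    have hmono : Monotone fun n : ℕ => {x | |g x| ≤ n} := fun a b hab x hx =>
      le_trans (show |g x| ≤ a from hx) (Nat.cast_le.2 hab)
    rw [← setLIntegral_univ, ← hU, setLIntegral_iUnion_of_directed _ hmono.directed_le]
    exact (iSup_le (lintegral_bounded_density_le hptop hpq f hg hind)).trans_lt
      ENNReal.ofReal_lt_top
  exact ⟨g, hg, hgq, apply_eq_integral_of_indicator hptop f hgq hind⟩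

end Dual

section Kernel

lemma exists_dual_ker_eq {E : Type*} [NormedAddCommGroup E] [NormedSpace ℝ E] (Z : Submodule ℝ E)
    (hZc : IsClosed (Z : Set E)) (hZ : Module.rank ℝ (E ⧸ Z) = 1) :
    ∃ f : E →L[ℝ] ℝ, f ≠ 0 ∧ ∀ x, f x = 0 ↔ x ∈ Z := by
  have : IsClosed (Z : Set E) := hZc
  have hfr : Module.finrank ℝ (E ⧸ Z) = 1 := Module.rank_eq_one_iff_finrank_eq_one.1 hZ
  have : FiniteDimensional ℝ (E ⧸ Z) := Module.finite_of_finrank_pos (by rw [hfr]; exact one_pos)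
  let e : (E ⧸ Z) ≃L[ℝ] ℝ := ContinuousLinearEquiv.ofFinrankEq (by rw [hfr, Module.finrank_self])
  have hk : ∀ x, ((e : (E ⧸ Z) →L[ℝ] ℝ) ∘L Z.mkQL) x = 0 ↔ x ∈ Z := fun x => by
    simp
  refine ⟨(e : (E ⧸ Z) →L[ℝ] ℝ) ∘L Z.mkQL, fun h0 => ?_, hk⟩
  have hall : Z = ⊤ := Submodule.eq_top_iff'.2 fun x => (hk x).1 (by rw [h0]; rfl)
  rw [← Submodule.Quotient.subsingleton_iff] at hall
  rw [Module.finrank_zero_of_subsingleton] at hfr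
  exact zero_ne_one hfr

lemma exists_density_of_codim_one {α : Type*} [MeasurableSpace α] {μ : Measure α}
    [IsFiniteMeasure μ] {p q : ℝ≥0∞} [Fact (1 ≤ p)] (hptop : p ≠ ⊤)
    (hpq : p.toReal.HolderConjugate q.toReal) (Z : Submodule ℝ (Lp ℝ p μ))
    (hZc : IsClosed (Z : Set (Lp ℝ p μ))) (hZ : Module.rank ℝ (Lp ℝ p μ ⧸ Z) = 1) :
    ∃ g : α → ℝ, Measurable g ∧ MemLp g q μ ∧ μ {x | g x ≠ 0} ≠ 0 ∧
      ∀ h : Lp ℝ p μ, h ∈ Z ↔ ∫ x, g x * h x ∂μ = 0 := by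
  have : ENNReal.HolderConjugate q p := ENNReal.HolderConjugate.of_toReal hpq.symm
  have : Fact (1 ≤ q) := ⟨ENNReal.HolderConjugate.one_le q p⟩
  obtain ⟨f, hf0, hfZ⟩ := exists_dual_ker_eq Z hZc hZ
  obtain ⟨g, hgm, hgq, hg⟩ := exists_memLp_density hptop hpq f
  refine ⟨g, hgm, hgq, fun h0 => hf0 ?_, fun h => by rw [← hfZ, hg]⟩
  ext h
  rw [hg]
  refine integral_eq_zero_of_ae ?_
  filter_upwards [ae_iff.2 h0] with x hx
  simp [hx]

end Kernel

/-- Every hyperplane of `L^p(0,1)`, seen in the first summand of `L^p(0,1) ⊕_p L^p(0,1)`, is carried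
by an isometry of the sum to the hyperplane of functions of mean zero. -/
lemma exists_linearIsometryEquiv_mem_iff_integral_eq_zero {p q : ℝ≥0∞} [Fact (1 ≤ p)]
    (hptop : p ≠ ⊤) (hpq : p.toReal.HolderConjugate q.toReal) {Z : Submodule ℝ (Lp ℝ p mu01)}
    {g : ℝ → ℝ} (hg : Measurable g) (hgq : MemLp g q mu01) (hg0 : mu01 {x | g x ≠ 0} ≠ 0)
    (hZ : ∀ h : Lp ℝ p mu01, h ∈ Z ↔ ∫ x, g x * h x ∂mu01 = 0)
    (J : Lp ℝ p (twoCopies mu01) ≃ₗᵢ[ℝ] WithLp p (Lp ℝ p mu01 × Lp ℝ p mu01))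
    (hJ : ∀ h, (J h).fst =ᵐ[mu01] fun x => h (x, true)) :
    ∃ T : Lp ℝ p (twoCopies mu01) ≃ₗᵢ[ℝ] Lp ℝ p (twoCopies mu01),
      ∀ h, (J (T h)).fst ∈ Z ↔ ∫ x, h (x, true) ∂mu01 = 0 := by
  classical
  set r := p.toReal with hr
  set s := q.toReal with hs
  have hr0 : 0 < r := hpq.pos
  have hs1 : 1 < s := hpq.symm.lt
  have hq0 : q ≠ 0 := fun h => by simp [hs, h] at hs1; linarith
  have hqtop : q ≠ ⊤ := fun h => by simp [hs, h] at hs1; linarith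
  let M : Measure (ℝ × Bool) := twoCopies mu01
  have hM : M = twoCopies mu01 := rfl
  set S : Set (ℝ × Bool) := {x | x.2 = true} with hS
  have hSm : MeasurableSet S := measurable_snd (measurableSet_singleton true)
  set A : Set (ℝ × Bool) := {x | x.2 = true ∧ g x.1 ≠ 0} with hA
  have hAm : MeasurableSet A := hSm.inter
    ((hg.comp measurable_fst) (measurableSet_singleton (0 : ℝ)).compl)
  set I : ℝ≥0∞ := ∫⁻ x in A, ‖g x.1‖ₑ ^ s ∂M with hI
  have hI0 : I ≠ 0 := by
    rw [hI, Ne, setLIntegral_eq_zero_iff hAm (by fun_prop)]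
    intro h
    refine hg0 ?_
    have h2 := (quasiMeasurePreserving_twoCopies true).ae h
    refine measure_mono_null (fun x hx => ?_) (ae_iff.1 h2)
    simpa [hA, hs1.le, (zero_lt_one.trans hs1)] using hx
  have hItop : I ≠ ⊤ := by
    have h := lintegral_rpow_enorm_lt_top_of_eLpNorm_lt_top hq0 hqtop hgq.2
    rw [hI, ← lintegral_indicator hAm, hM, lintegral_twoCopies]
    refine ((add_le_add (lintegral_mono (g := fun x => ‖g x‖ₑ ^ s) fun x => ?_)
      (lintegral_mono (g := fun _ => 0) fun x => ?_)).trans_lt ?_).ne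
    · exact indicator_le_self' (by simp) _
    · simp [hA]
    · simpa using h
  have hC0 : M Aᶜ ≠ 0 := by
    rw [hM, twoCopies_apply hAm.compl]
    simp [hA]
  have hCtop : M Aᶜ ≠ ⊤ := measure_ne_top _ _
  have hroot : ∀ t : ℝ≥0∞, t ≠ 0 → t ≠ ⊤ → ∃ k : ℝ, 0 < k ∧ ‖k‖ₑ ^ r * t = 1 := by
    intro t h0 htop
    refine ⟨t.toReal ^ (-r⁻¹), Real.rpow_pos_of_pos (ENNReal.toReal_pos h0 htop) _, ?_⟩
    rw [Real.enorm_eq_ofReal (by positivity),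
      ← ENNReal.ofReal_rpow_of_pos (ENNReal.toReal_pos h0 htop), ENNReal.ofReal_toReal htop,
      ← ENNReal.rpow_mul, neg_mul, inv_mul_cancel₀ hr0.ne', ENNReal.rpow_neg_one,
      ENNReal.inv_mul_cancel h0 htop]
  obtain ⟨k, hk, hkI⟩ := hroot I hI0 hItop
  obtain ⟨c, hc, hcC⟩ := hroot _ hC0 hCtop
  set w : ℝ × Bool → ℝ := A.piecewise (fun x => k * (g x.1 * |g x.1| ^ (s - 2))) fun _ => c with hw
  have hwm : Measurable w := Measurable.piecewise hAm (by fun_prop) measurable_const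
  have hwA : ∀ x ∈ A, w x = k * (g x.1 * |g x.1| ^ (s - 2)) := fun x hx =>
    piecewise_eq_of_mem _ _ _ hx
  have hwA' : ∀ x ∈ Aᶜ, w x = c := fun x hx => piecewise_eq_of_notMem _ _ _ hx
  have hw0 : ∀ x, w x ≠ 0 := fun x => by
    by_cases hx : x ∈ A
    · rw [hwA x hx]
      exact mul_ne_zero hk.ne' (mul_ne_zero hx.2 (Real.rpow_pos_of_pos (abs_pos.2 hx.2) _).ne')
    · rw [hwA' x hx]; exact hc.ne'
  set ρ : ℝ × Bool → ℝ≥0∞ := fun x => ‖w x‖ₑ ^ r with hρ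
  have hρm : Measurable ρ := by fun_prop
  have hρA : ∀ x ∈ A, ρ x = ‖k‖ₑ ^ r * ‖g x.1‖ₑ ^ s := fun x hx => by
    rw [hρ]
    simp only
    rw [hwA x hx, enorm_mul, ENNReal.mul_rpow_of_nonneg _ _ hr0.le, ← Real.enorm_abs (_ * _),
      abs_mul_rpow_abs_sub_two hs1, Real.enorm_rpow_of_nonneg (abs_nonneg _) (by linarith),
      Real.enorm_abs, ← ENNReal.rpow_mul, hpq.symm.sub_one_mul_conj]
  have hD1 : M.withDensity ρ A = 1 := by
    rw [withDensity_apply _ hAm, setLIntegral_congr_fun hAm hρA,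
      lintegral_const_mul _ (by fun_prop), hkI]
  have hD2 : M.withDensity ρ Aᶜ = 1 := by
    have : ∀ x ∈ Aᶜ, ρ x = ‖c‖ₑ ^ r := fun x hx => by rw [← hwA' x hx]
    rw [withDensity_apply _ hAm.compl, setLIntegral_congr_fun hAm.compl this,
      setLIntegral_const, hcC]
  have : NullSingletonClass (M.withDensity ρ) :=
    ⟨fun x => withDensity_absolutelyContinuous _ _ (measure_singleton x)⟩
  obtain ⟨φ, hφ, hφM, ⟨N, hN, hN0, hNi⟩, hφA⟩ :=
    exists_map_eq_twoCopies (M.withDensity ρ) hAm hD1 hD2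
  obtain ⟨T, hT⟩ := exists_weightedComp_linearIsometryEquiv (p := p) hptop hφ hwm hw0 hφM
    ⟨N, hN, absolutelyContinuous_weight hwm hw0 hN0, hNi⟩
  refine ⟨T, fun h => ?_⟩
  have hpt : ∀ x, S.indicator (fun x => g x.1 * (w x * h (φ x))) x =
      k / k ^ r * ((ρ x).toReal * A.indicator (fun x => h (φ x)) x) := fun x => by
    by_cases hx : x ∈ A
    · rw [indicator_of_mem (show x ∈ S from hx.1), indicator_of_mem hx, hρA x hx, hwA x hx,
        ENNReal.toReal_mul, ← ENNReal.toReal_rpow, ← ENNReal.toReal_rpow, toReal_enorm,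
        toReal_enorm, Real.norm_of_nonneg hk.le, Real.norm_eq_abs,
        ← mul_mul_rpow_abs_sub_two hs1 (g x.1)]
      have : k ^ r ≠ 0 := (Real.rpow_pos_of_pos hk _).ne'
      field_simp
    · rw [indicator_of_notMem hx, mul_zero, mul_zero]
      by_cases hxS : x ∈ S
      · have : g x.1 = 0 := by_contra fun h => hx ⟨hxS, h⟩
        rw [indicator_of_mem hxS, this, zero_mul]
      · rw [indicator_of_notMem hxS]
  have hleft : ∫ x, g x * (J (T h)).fst x ∂mu01 =
      k / k ^ r * ∫ x, (ρ x).toReal * A.indicator (fun x => h (φ x)) x ∂M := by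
    have h1 : ∫ x, g x * (J (T h)).fst x ∂mu01 = ∫ x in S, g x.1 * T h x ∂M := by
      rw [setIntegral_twoCopies]
      refine integral_congr_ae ?_
      filter_upwards [hJ (T h)] with x hx
      rw [hx]
    have h2 : ∫ x in S, g x.1 * T h x ∂M = ∫ x in S, g x.1 * (w x * h (φ x)) ∂M := by
      refine integral_congr_ae (ae_restrict_of_ae ?_)
      filter_upwards [hT h] with x hx
      rw [hx]
    rw [h1, h2, ← integral_indicator hSm, ← integral_const_mul]
    exact integral_congr_ae (ae_of_all _ hpt)
  have hright : ∀ f : ℝ × Bool → ℝ, AEStronglyMeasurable f (twoCopies mu01) →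
      ∫ x, f (x, true) ∂mu01 = ∫ x, (ρ x).toReal * A.indicator (fun x => f (φ x)) x ∂M := by
    intro f hf
    have h1 : ∀ x, S.indicator f (φ x) = A.indicator (fun x => f (φ x)) x := fun x => by
      by_cases hx : x ∈ A
      · rw [indicator_of_mem hx, indicator_of_mem (show φ x ∈ S from (hφA x).2 hx)]
      · rw [indicator_of_notMem hx, indicator_of_notMem (s := S) fun h' => hx ((hφA x).1 h')]
    rw [← setIntegral_twoCopies f, ← integral_indicator hSm]
    rw [← hφM] at hf ⊢
    rw [integral_map hφ.aemeasurable (hf.indicator hSm),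
      integral_congr_ae (ae_of_all _ h1), integral_withDensity_eq_integral_toReal_smul hρm
        (ae_of_all _ fun x => ENNReal.rpow_lt_top_of_nonneg hr0.le (by simp))]
    rfl
  rw [hZ, hleft, hright h (Lp.aestronglyMeasurable h), mul_eq_zero, or_iff_right]
  exact (div_pos hk (Real.rpow_pos_of_pos hk _)).ne'

/-- For `1 < p < ∞` and any two `1`-codimensional closed subspaces `Z₁, Z₂` of `L^p(0,1)`,
the `ℓ^p`-sums `Z₁ ⊕_p L^p` and `Z₂ ⊕_p L^p` are isometrically isomorphic. -/
theorem stmt_19 (p : ℝ≥0∞) [Fact (1 ≤ p)] (hp1 : 1 < p) (hptop : p ≠ ⊤)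
    (Z₁ Z₂ : Submodule ℝ (Lp ℝ p mu01))
    (hZ₁c : IsClosed (Z₁ : Set (Lp ℝ p mu01))) (hZ₂c : IsClosed (Z₂ : Set (Lp ℝ p mu01)))
    (hZ₁ : Module.rank ℝ (Lp ℝ p mu01 ⧸ Z₁) = 1)
    (hZ₂ : Module.rank ℝ (Lp ℝ p mu01 ⧸ Z₂) = 1) :
    Nonempty (WithLp p (Z₁ × Lp ℝ p mu01) ≃ₗᵢ[ℝ] WithLp p (Z₂ × Lp ℝ p mu01)) := by
  have hr : 1 < p.toReal := by
    rw [← ENNReal.toReal_one]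
    exact (ENNReal.toReal_lt_toReal ENNReal.one_ne_top hptop).2 hp1
  obtain ⟨q, hpq⟩ : ∃ q : ℝ≥0∞, p.toReal.HolderConjugate q.toReal := by
    refine ⟨ENNReal.ofReal p.toReal.conjExponent, ?_⟩
    have h := Real.HolderConjugate.conjExponent hr
    rwa [ENNReal.toReal_ofReal h.symm.nonneg]
  obtain ⟨J, hJ⟩ := exists_twoCopies_linearIsometryEquiv mu01 hptop
  obtain ⟨g₁, hg₁, hgq₁, hg0₁, hgZ₁⟩ := exists_density_of_codim_one hptop hpq Z₁ hZ₁c hZ₁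
  obtain ⟨g₂, hg₂, hgq₂, hg0₂, hgZ₂⟩ := exists_density_of_codim_one hptop hpq Z₂ hZ₂c hZ₂
  obtain ⟨T₁, hT₁⟩ :=
    exists_linearIsometryEquiv_mem_iff_integral_eq_zero hptop hpq hg₁ hgq₁ hg0₁ hgZ₁ J hJ
  obtain ⟨T₂, hT₂⟩ :=
    exists_linearIsometryEquiv_mem_iff_integral_eq_zero hptop hpq hg₂ hgq₂ hg0₂ hgZ₂ J hJ
  refine nonempty_linearIsometryEquiv_of_fst_mem_iff hptop
    (((J.symm.trans T₁.symm).trans T₂).trans J) fun u => ?_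
  have h := hT₁ (T₁.symm (J.symm u))
  rw [T₁.apply_symm_apply, J.apply_symm_apply] at h
  rw [h]
  exact hT₂ _
end
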